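/- arXiv:2411.19499 — 14 statements merged into one kernel-verified Lean document; each statement's English description precedes it below -/
import Mathlib

section
/- Let X : ℝ² → ℝ³ be the spacelike Enneper surface X(u,v) = ( e^u(e^{2u}·cos(3v) + 3·cos v)/3 , e^u(e^{2u}·sin(3v) − 3·sin v)/3 , −e^{2u}·cos(2v) ), and for u ≠ 0 define the unit normal N(u,v) = (X_u ×_L X_v)/(e^{2u}(e^{2u}−1)²). Then for all u ≠ 0 and all v: ⟨N, N⟩ = −1, ⟨N, X_u⟩ = ⟨N, X_v⟩ = 0, and the second fundamental form coefficients are ⟨X_{uu}, N⟩ = 2e^{2u}·cos(2v), ⟨X_{uv}, N⟩ = −2e^{2u}·sin(2v), ⟨X_{vv}, N⟩ = −2e^{2u}·cos(2v). (Equivalently, the Weingarten matrix with respect to (X_u, X_v) is R_{−v}·diag(2/(e^{2u}−1)², −2/(e^{2u}−1)²)·R_v, where R_v is the Euclidean rotation of angle v.) -/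
noncomputable section

open Real

/-- The Lorentzian inner product on `ℝ³ = ℝ × ℝ × ℝ`:
`⟨x, y⟩ = x₁y₁ + x₂y₂ − x₃y₃`. -/
def lint (x y : ℝ × ℝ × ℝ) : ℝ := x.1 * y.1 + x.2.1 * y.2.1 - x.2.2 * y.2.2

/-- The Lorentzian cross product on `ℝ³`, characterized by `⟨x ×_L y, z⟩ = det(x,y,z)`. -/
def lcross (x y : ℝ × ℝ × ℝ) : ℝ × ℝ × ℝ :=
  (x.2.1 * y.2.2 - x.2.2 * y.2.1,
   x.2.2 * y.1 - x.1 * y.2.2,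
   x.2.1 * y.1 - x.1 * y.2.1)

/-- Partial derivative with respect to the first variable. -/
def pu (X : ℝ → ℝ → ℝ × ℝ × ℝ) (u v : ℝ) : ℝ × ℝ × ℝ := deriv (fun t => X t v) u

/-- Partial derivative with respect to the second variable. -/
def pv (X : ℝ → ℝ → ℝ × ℝ × ℝ) (u v : ℝ) : ℝ × ℝ × ℝ := deriv (fun t => X u t) v

/-- The spacelike Enneper surface. -/
def EnneperS (u v : ℝ) : ℝ × ℝ × ℝ :=
  (Real.exp u * (Real.exp (2 * u) * Real.cos (3 * v) + 3 * Real.cos v) / 3,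
   Real.exp u * (Real.exp (2 * u) * Real.sin (3 * v) - 3 * Real.sin v) / 3,
   -(Real.exp (2 * u) * Real.cos (2 * v)))

/-- The unit normal of the spacelike Enneper surface. -/
def EnneperSNormal (u v : ℝ) : ℝ × ℝ × ℝ :=
  (Real.exp (2 * u) * (Real.exp (2 * u) - 1) ^ 2)⁻¹ •
    lcross (pu EnneperS u v) (pv EnneperS u v)

theorem hexp (k t : ℝ) : HasDerivAt (fun x => Real.exp (k * x)) (k * Real.exp (k * t)) t := by
  have h := ((hasDerivAt_id t).const_mul k).exp
  simpa [mul_comm] using h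

theorem hcos (k t : ℝ) : HasDerivAt (fun x => Real.cos (k * x)) (-(k * Real.sin (k * t))) t := by
  have h := ((hasDerivAt_id t).const_mul k).cos
  simpa [mul_comm] using h

theorem hsin (k t : ℝ) : HasDerivAt (fun x => Real.sin (k * x)) (k * Real.cos (k * t)) t := by
  have h := ((hasDerivAt_id t).const_mul k).sin
  simpa [mul_comm] using h

theorem exp_two (u : ℝ) : Real.exp (2 * u) = Real.exp u ^ 2 := by
  rw [← Real.exp_nat_mul]; norm_num

theorem exp_three (u : ℝ) : Real.exp (3 * u) = Real.exp u ^ 3 := by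
  rw [← Real.exp_nat_mul]; norm_num

/-- General family in which all partial derivatives live. -/
def fam (a b c a' b' c' u v : ℝ) : ℝ × ℝ × ℝ :=
  (Real.exp (3 * u) * (a * Real.cos (3 * v) + a' * Real.sin (3 * v))
      + Real.exp (1 * u) * (b * Real.cos (1 * v) + b' * Real.sin (1 * v)),
   Real.exp (3 * u) * (a * Real.sin (3 * v) - a' * Real.cos (3 * v))
      + Real.exp (1 * u) * (-b * Real.sin (1 * v) + b' * Real.cos (1 * v)),
   Real.exp (2 * u) * (c * Real.cos (2 * v) + c' * Real.sin (2 * v)))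

theorem fam_pu (a b c a' b' c' : ℝ) :
    pu (fam a b c a' b' c') = fam (3 * a) b (2 * c) (3 * a') b' (2 * c') := by
  funext u v
  have h := (((hexp 3 u).mul_const (a * Real.cos (3 * v) + a' * Real.sin (3 * v))).add
      ((hexp 1 u).mul_const (b * Real.cos (1 * v) + b' * Real.sin (1 * v)))).prodMk
    ((((hexp 3 u).mul_const (a * Real.sin (3 * v) - a' * Real.cos (3 * v))).add
      ((hexp 1 u).mul_const (-b * Real.sin (1 * v) + b' * Real.cos (1 * v)))).prodMk
      ((hexp 2 u).mul_const (c * Real.cos (2 * v) + c' * Real.sin (2 * v))))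
  refine h.deriv.trans ?_
  simp only [fam, Prod.mk.injEq]
  refine ⟨?_, ?_, ?_⟩ <;> ring

theorem fam_pv (a b c a' b' c' : ℝ) :
    pv (fam a b c a' b' c') = fam (3 * a') b' (2 * c') (-3 * a) (-b) (-2 * c) := by
  funext u v
  have h := (((((hcos 3 v).const_mul a).add ((hsin 3 v).const_mul a')).const_mul
        (Real.exp (3 * u))).add
      ((((hcos 1 v).const_mul b).add ((hsin 1 v).const_mul b')).const_mul
        (Real.exp (1 * u)))).prodMk
    ((((((hsin 3 v).const_mul a).sub ((hcos 3 v).const_mul a')).const_mul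
        (Real.exp (3 * u))).add
      ((((hsin 1 v).const_mul (-b)).add ((hcos 1 v).const_mul b')).const_mul
        (Real.exp (1 * u)))).prodMk
      ((((hcos 2 v).const_mul c).add ((hsin 2 v).const_mul c')).const_mul (Real.exp (2 * u))))
  refine h.deriv.trans ?_
  simp only [fam, Prod.mk.injEq]
  refine ⟨?_, ?_, ?_⟩ <;> ring

theorem enneper_fam : EnneperS = fam (1 / 3) 1 (-1) 0 0 0 := by
  funext u v
  simp only [EnneperS, fam, Prod.mk.injEq, exp_two, exp_three, one_mul]
  refine ⟨?_, ?_, ?_⟩ <;> ring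

theorem normal_eq (u v : ℝ) (hu : u ≠ 0) : EnneperSNormal u v =
    (2 * Real.exp u * Real.cos v / (Real.exp u ^ 2 - 1),
     2 * Real.exp u * Real.sin v / (Real.exp u ^ 2 - 1),
     -(Real.exp u ^ 2 + 1) / (Real.exp u ^ 2 - 1)) := by
  have hr := (Real.exp_pos u).ne'
  have hd : Real.exp u ^ 2 - 1 ≠ 0 := by
    rw [← exp_two, sub_ne_zero]
    simpa using hu
  simp only [EnneperSNormal, enneper_fam, fam_pu, fam_pv]
  simp only [fam, lcross, exp_two, exp_three, one_mul, Prod.smul_mk, smul_eq_mul, Prod.mk.injEq,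
    Real.cos_two_mul, Real.sin_two_mul, Real.cos_three_mul, Real.sin_three_mul]
  have hs := Real.sin_sq_add_cos_sq v
  generalize Real.exp u = r at *
  generalize Real.sin v = s at *
  generalize Real.cos v = c at *
  have hs4 : s ^ 4 = (1 - c ^ 2) ^ 2 := by rw [← hs]; ring
  refine ⟨?_, ?_, ?_⟩ <;> field_simp <;> grind

/-- The unit normal and second fundamental form of the spacelike Enneper surface:
the normal is unit timelike, orthogonal to the tangent vectors, and the second
fundamental form coefficients are
`e = 2e^{2u}cos 2v`, `f = −2e^{2u}sin 2v`, `g = −2e^{2u}cos 2v`. -/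
theorem stmt1 (u v : ℝ) (hu : u ≠ 0) :
    lint (EnneperSNormal u v) (EnneperSNormal u v) = -1 ∧
    lint (EnneperSNormal u v) (pu EnneperS u v) = 0 ∧
    lint (EnneperSNormal u v) (pv EnneperS u v) = 0 ∧
    lint (pu (pu EnneperS) u v) (EnneperSNormal u v)
        = 2 * Real.exp (2 * u) * Real.cos (2 * v) ∧
    lint (pv (pu EnneperS) u v) (EnneperSNormal u v)
        = -(2 * Real.exp (2 * u) * Real.sin (2 * v)) ∧
    lint (pv (pv EnneperS) u v) (EnneperSNormal u v)
        = -(2 * Real.exp (2 * u) * Real.cos (2 * v)) := by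
  have hr := (Real.exp_pos u).ne'
  have hd : Real.exp u ^ 2 - 1 ≠ 0 := by
    rw [← exp_two, sub_ne_zero]
    simpa using hu
  rw [normal_eq u v hu]
  simp only [enneper_fam, fam_pu, fam_pv]
  simp only [fam, lint, exp_two, exp_three, one_mul,
    Real.cos_two_mul, Real.sin_two_mul, Real.cos_three_mul, Real.sin_three_mul]
  have hs := Real.sin_sq_add_cos_sq v
  generalize Real.exp u = r at *
  generalize Real.sin v = s at *
  generalize Real.cos v = c at *
  refine ⟨?_, ?_, ?_, ?_, ?_, ?_⟩ <;> field_simp <;> grind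
end
end

section
/- Let a ∈ ℝ, A > 0, B > 0 and ε ∈ {−1, 1}. Then the function ρ(u) = (e^{2au}/(2B))·(−ε·A·e^{Bu} + e^{−Bu}/A) satisfies the differential equation ρ(u)·ρ''(u) − ρ'(u)² + ε·e^{4au} = 0 for every u ∈ ℝ. -/
noncomputable section

open Real

theorem deriv_two_exp (c d p q : ℝ) :
    deriv (fun u : ℝ => c * Real.exp (p * u) + d * Real.exp (q * u)) =
      fun u : ℝ => (c * p) * Real.exp (p * u) + (d * q) * Real.exp (q * u) := by
  funext u
  have hp : ∀ r : ℝ, HasDerivAt (fun u : ℝ => Real.exp (r * u)) (Real.exp (r * u) * r) u := by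
    intro r
    have := ((hasDerivAt_id u).const_mul r).exp
    simpa using this
  have h := ((hp p).const_mul c).add ((hp q).const_mul d)
  refine Eq.trans (HasDerivAt.deriv h) ?_
  ring

/-- For every `a ∈ ℝ`, `A, B > 0` and `ε ∈ {−1, 1}`, the function
`ρ(u) = (e^{2au}/(2B))·(−ε·A·e^{Bu} + e^{−Bu}/A)` solves
`ρρ'' − ρ'² + ε·e^{4au} = 0`. -/
theorem stmt4 (a A B ε : ℝ) (hA : 0 < A) (hB : 0 < B) (hε : ε = -1 ∨ ε = 1)
    (ρ : ℝ → ℝ)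
    (hρ : ∀ u : ℝ, ρ u = Real.exp (2 * a * u) / (2 * B) *
        (-(ε * A * Real.exp (B * u)) + Real.exp (-(B * u)) / A)) :
    ∀ u : ℝ, ρ u * deriv (deriv ρ) u - (deriv ρ u) ^ 2 + ε * Real.exp (4 * a * u) = 0 := by
  have hfun : ρ = fun u : ℝ => (-(ε * A) / (2 * B)) * Real.exp ((2 * a + B) * u)
      + (1 / (2 * B * A)) * Real.exp ((2 * a - B) * u) := by
    funext u
    rw [hρ u, show (2 * a + B) * u = 2 * a * u + B * u by ring,
      show (2 * a - B) * u = 2 * a * u + -(B * u) by ring, Real.exp_add, Real.exp_add]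
    field_simp
  intro u
  rw [hfun, deriv_two_exp, deriv_two_exp]
  have he : Real.exp (4 * a * u) = Real.exp ((2 * a + B) * u) * Real.exp ((2 * a - B) * u) := by
    rw [← Real.exp_add]
    congr 1
    ring
  rw [he]
  beta_reduce
  generalize Real.exp ((2 * a + B) * u) = x
  generalize Real.exp ((2 * a - B) * u) = y
  field_simp
  ring
end
end

section
/- Let I ⊆ ℝ be a nonempty open interval, a ∈ ℝ, and let ρ : I → ℝ be twice continuously differentiable with ρ(u) > 0 for all u ∈ I and satisfying ρ(u)·ρ''(u) − ρ'(u)² = e^{4au} for all u ∈ I. Then there exist constants A > 0 and B > 0 such that ρ(u) = (e^{2au}/(2B))·(A·e^{Bu} + e^{−Bu}/A) for all u ∈ I. -/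
noncomputable section

open Real

lemma const_aux (I : Set ℝ) (hopen : IsOpen I) (hconn : I.OrdConnected) (f : ℝ → ℝ)
    (h : ∀ u ∈ I, HasDerivAt f 0 u) (x y : ℝ) (hx : x ∈ I) (hy : y ∈ I) : f x = f y := by
  refine hopen.is_const_of_deriv_eq_zero hconn.isPreconnected ?_ ?_ hx hy
  · intro u hu
    exact (h u hu).differentiableAt.differentiableWithinAt
  · intro u hu
    exact (h u hu).deriv

lemma core_aux (I : Set ℝ) (hne : I.Nonempty) (hopen : IsOpen I)
    (hconn : I.OrdConnected) (s t r : ℝ → ℝ)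
    (hd1 : ∀ u ∈ I, HasDerivAt s (t u) u)
    (hd2 : ∀ u ∈ I, HasDerivAt t (r u) u)
    (hpos : ∀ u ∈ I, 0 < s u)
    (hode : ∀ u ∈ I, s u * r u - (t u) ^ 2 = 1) :
    ∃ A B : ℝ, 0 < A ∧ 0 < B ∧ ∀ u ∈ I,
      2 * B * s u = A * Real.exp (B * u) + Real.exp (-(B * u)) / A := by
  obtain ⟨x, hx⟩ := hne
  have hE : ∀ u ∈ I, (t u ^ 2 + 1) / s u ^ 2 = (t x ^ 2 + 1) / s x ^ 2 := by
    intro u hu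
    refine const_aux I hopen hconn (fun u => (t u ^ 2 + 1) / s u ^ 2) ?_ u x hu hx
    intro v hv
    have hs := (hpos v hv).ne'
    refine HasDerivAt.congr_deriv ((((hd2 v hv).pow 2).add_const 1).div ((hd1 v hv).pow 2) (pow_ne_zero 2 hs)) ?_
    rw [div_eq_zero_iff]
    left
    have h := hode v hv
    simp
    linear_combination (2 * s v * t v) * h
  set B := √((t x ^ 2 + 1) / s x ^ 2) with hB
  have hsx := hpos x hx
  have hBpos : 0 < B := by rw [hB]; positivity
  have hBsq : B ^ 2 = (t x ^ 2 + 1) / s x ^ 2 := Real.sq_sqrt (by positivity)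
  have hfi : ∀ u ∈ I, B ^ 2 * s u ^ 2 = t u ^ 2 + 1 := by
    intro u hu
    have hs := (hpos u hu).ne'
    rw [hBsq, ← hE u hu]
    field_simp
  have hlin : ∀ u ∈ I, r u = B ^ 2 * s u := by
    intro u hu
    have hs := (hpos u hu).ne'
    apply mul_left_cancel₀ hs
    linear_combination hode u hu - hfi u hu
  have hP : ∀ u ∈ I, (t u + B * s u) * exp (-(B * u)) = (t x + B * s x) * exp (-(B * x)) := by
    intro u hu
    refine const_aux I hopen hconn (fun u => (t u + B * s u) * exp (-(B * u))) ?_ u x hu hx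
    intro v hv
    refine HasDerivAt.congr_deriv (((hd2 v hv).add ((hd1 v hv).const_mul B)).mul
      (((hasDerivAt_id v).const_mul B).neg.exp)) ?_
    simp
    linear_combination (exp (-(B * v))) * hlin v hv
  have hQ : ∀ u ∈ I, (B * s u - t u) * exp (B * u) = (B * s x - t x) * exp (B * x) := by
    intro u hu
    refine const_aux I hopen hconn (fun u => (B * s u - t u) * exp (B * u)) ?_ u x hu hx
    intro v hv
    refine HasDerivAt.congr_deriv ((((hd1 v hv).const_mul B).sub (hd2 v hv)).mul
      (((hasDerivAt_id v).const_mul B).exp)) ?_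
    simp
    linear_combination (-exp (B * v)) * hlin v hv
  have hee : ∀ u : ℝ, exp (-(B * u)) * exp (B * u) = 1 := by
    intro u
    rw [← exp_add]; simp
  have habs : 0 < t x + B * s x := by
    have := hfi x hx
    have h2 : 0 < B * s x := by positivity
    by_contra hc
    nlinarith
  refine ⟨(t x + B * s x) * exp (-(B * x)), B, by positivity, hBpos, ?_⟩
  intro u hu
  have hinv : exp (-(B * u)) / ((t x + B * s x) * exp (-(B * x)))
      = exp (-(B * u)) * ((B * s x - t x) * exp (B * x)) := by
    rw [div_eq_iff (by positivity)]
    linear_combination (-exp (-(B * u))) * (hfi x hx)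
      - exp (-(B * u)) * (B ^ 2 * s x ^ 2 - t x ^ 2) * hee x
  rw [hinv, ← hP u hu, ← hQ u hu]
  linear_combination (-2 * B * s u) * hee u

/-- Classification of the positive solutions of `ρρ'' − ρ'² = e^{4au}` on a nonempty
open interval: they are exactly the functions
`ρ(u) = (e^{2au}/(2B))·(A·e^{Bu} + e^{−Bu}/A)` with `A, B > 0`. -/
theorem stmt5 (I : Set ℝ) (hne : I.Nonempty) (hopen : IsOpen I)
    (hconn : I.OrdConnected) (a : ℝ) (ρ ρ' ρ'' : ℝ → ℝ)
    (hd1 : ∀ u ∈ I, HasDerivAt ρ (ρ' u) u)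
    (hd2 : ∀ u ∈ I, HasDerivAt ρ' (ρ'' u) u)
    (hcont : ContinuousOn ρ'' I)
    (hpos : ∀ u ∈ I, 0 < ρ u)
    (hode : ∀ u ∈ I, ρ u * ρ'' u - (ρ' u) ^ 2 = Real.exp (4 * a * u)) :
    ∃ A B : ℝ, 0 < A ∧ 0 < B ∧ ∀ u ∈ I,
      ρ u = Real.exp (2 * a * u) / (2 * B) *
        (A * Real.exp (B * u) + Real.exp (-(B * u)) / A) := by
  have hexp : ∀ u : ℝ, HasDerivAt (fun u => exp (-(2 * a * u))) (exp (-(2 * a * u)) * (-(2 * a))) u := by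
    intro u
    simpa using ((hasDerivAt_id u).const_mul (2 * a)).neg.exp
  obtain ⟨A, B, hA, hB, h⟩ := core_aux I hne hopen hconn
    (fun u => ρ u * exp (-(2 * a * u)))
    (fun u => (ρ' u - 2 * a * ρ u) * exp (-(2 * a * u)))
    (fun u => (ρ'' u - 4 * a * ρ' u + 4 * a ^ 2 * ρ u) * exp (-(2 * a * u)))
    (by
      intro u hu
      refine HasDerivAt.congr_deriv ((hd1 u hu).mul (hexp u)) ?_
      ring)
    (by
      intro u hu
      refine HasDerivAt.congr_deriv (((hd2 u hu).sub ((hd1 u hu).const_mul (2 * a))).mul (hexp u)) ?_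
      simp
      ring)
    (by
      intro u hu
      have := hpos u hu
      positivity)
    (by
      intro u hu
      have h1 : exp (4 * a * u) * (exp (-(2 * a * u)) * exp (-(2 * a * u))) = 1 := by
        rw [← exp_add, ← exp_add, ← exp_zero]
        congr 1
        ring
      linear_combination (exp (-(2 * a * u)) * exp (-(2 * a * u))) * hode u hu + h1)
  refine ⟨A, B, hA, hB, ?_⟩
  intro u hu
  have h1 : exp (2 * a * u) * exp (-(2 * a * u)) = 1 := by
    rw [← exp_add]; simp
  rw [← h u hu]
  field_simp
  linear_combination (-ρ u) * h1
end
end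

section
/- (Analytic core of the main theorem, spacelike case.) Let I, J ⊆ ℝ be nonempty open intervals. Let ρ, λ₁, λ₂ : I → ℝ and α : J → ℝ be differentiable, with ρ(u) > 0 and λ₁(u) ≠ λ₂(u) for every u ∈ I, and suppose there exists v₀ ∈ J with sin(2α(v₀)) ≠ 0. Assume the Codazzi equations hold: for all u ∈ I and v ∈ J, (i) sin(2α(v))·ρ(u)·(λ₁'(u) + λ₂'(u)) = 0 and (ii) −λ₁'(u)·sin²(α(v)) + λ₂'(u)·cos²(α(v)) + (1/ρ(u))·(λ₁(u) − λ₂(u))·(ρ(u)·α'(v) − ρ'(u)) = 0. Then λ₁ + λ₂ is constant on I (so the mean curvature is constant) and there exist constants a, c ∈ ℝ with α(v) = a·v + c for all v ∈ J. -/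
noncomputable section

open Real

theorem const_aux_s6 (I : Set ℝ) (hIopen : IsOpen I) (hIconn : I.OrdConnected)
    (hne : I.Nonempty) (f : ℝ → ℝ) (hf : ∀ u ∈ I, HasDerivAt f 0 u) :
    ∃ c, ∀ u ∈ I, f u = c := by
  obtain ⟨x, hx⟩ := hne
  exact ⟨f x, fun u hu => hIopen.is_const_of_deriv_eq_zero hIconn.isPreconnected
    (fun y hy => (hf y hy).differentiableAt.differentiableWithinAt)
    (fun y hy => (hf y hy).deriv) hu hx⟩

/-- Analytic core of the main theorem, spacelike case.  If the Codazzi equations of a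
spacelike intrinsic rotational surface with twist `α` hold, there are no umbilic
points (`λ₁ ≠ λ₂`), and `α` is not an integer multiple of `π/2` at some point of `J`
(`sin(2α(v₀)) ≠ 0`), then the mean curvature is constant (`λ₁ + λ₂` is constant) and
the twist is linear, `α(v) = a·v + c`. -/
theorem stmt6 (I J : Set ℝ)
    (hIne : I.Nonempty) (hIopen : IsOpen I) (hIconn : I.OrdConnected)
    (hJne : J.Nonempty) (hJopen : IsOpen J) (hJconn : J.OrdConnected)
    (ρ ρ' lam₁ lam₁' lam₂ lam₂' α α' : ℝ → ℝ)
    (hρ : ∀ u ∈ I, HasDerivAt ρ (ρ' u) u)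
    (hl₁ : ∀ u ∈ I, HasDerivAt lam₁ (lam₁' u) u)
    (hl₂ : ∀ u ∈ I, HasDerivAt lam₂ (lam₂' u) u)
    (hα : ∀ v ∈ J, HasDerivAt α (α' v) v)
    (hpos : ∀ u ∈ I, 0 < ρ u)
    (humb : ∀ u ∈ I, lam₁ u ≠ lam₂ u)
    (hv₀ : ∃ v₀ ∈ J, Real.sin (2 * α v₀) ≠ 0)
    (hcod1 : ∀ u ∈ I, ∀ v ∈ J,
      Real.sin (2 * α v) * ρ u * (lam₁' u + lam₂' u) = 0)
    (hcod2 : ∀ u ∈ I, ∀ v ∈ J,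
      -(lam₁' u) * Real.sin (α v) ^ 2 + lam₂' u * Real.cos (α v) ^ 2
        + 1 / ρ u * (lam₁ u - lam₂ u) * (ρ u * α' v - ρ' u) = 0) :
    (∃ H : ℝ, ∀ u ∈ I, lam₁ u + lam₂ u = H) ∧
    (∃ a c : ℝ, ∀ v ∈ J, α v = a * v + c) := by
  obtain ⟨v₀, hv, hs⟩ := hv₀
  have h0 : ∀ u ∈ I, lam₁' u + lam₂' u = 0 := fun u hu => by
    have := hcod1 u hu v₀ hv
    have hr := (hpos u hu).ne'
    simpa [hs, hr] using this
  constructor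
  · exact const_aux_s6 I hIopen hIconn hIne (fun u => lam₁ u + lam₂ u)
      (fun u hu => by simpa [h0 u hu] using (hl₁ u hu).fun_add (hl₂ u hu))
  · obtain ⟨u, hu⟩ := hIne
    have hr := (hpos u hu).ne'
    have hd := sub_ne_zero.mpr (humb u hu)
    have key : ∀ v ∈ J, α' v = α' v₀ := fun v hvJ => by
      have e1 := hcod2 u hu v hvJ
      have e2 := hcod2 u hu v₀ hv
      have h1 : lam₁' u = -lam₂' u := by linarith [h0 u hu]
      rw [h1] at e1 e2
      have s1 := Real.sin_sq_add_cos_sq (α v)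
      have s2 := Real.sin_sq_add_cos_sq (α v₀)
      have e3 : 1 / ρ u * (lam₁ u - lam₂ u) * ρ u * (α' v - α' v₀) = 0 := by
        linear_combination e1 - e2 - lam₂' u * s1 + lam₂' u * s2
      have e4 : 1 / ρ u * (lam₁ u - lam₂ u) * ρ u ≠ 0 :=
        mul_ne_zero (mul_ne_zero (one_div_ne_zero hr) hd) hr
      exact sub_eq_zero.mp ((mul_eq_zero.mp e3).resolve_left e4)
    obtain ⟨c, hc⟩ := const_aux_s6 J hJopen hJconn hJne (fun v => α v - α' v₀ * v)
      (fun v hvJ => by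
        simpa [key v hvJ] using
          (hα v hvJ).fun_sub ((hasDerivAt_id v).const_mul (α' v₀)))
    exact ⟨α' v₀, c, fun v hvJ => by have := hc v hvJ; linarith⟩
end
end

section
/- (Analytic core of the mixed-case theorem.) Let I, J ⊆ ℝ be nonempty open intervals. Let ρ, λ₁, λ₂ : I → ℝ and α : J → ℝ be differentiable, with ρ(u) > 0 and λ₁(u) ≠ λ₂(u) for every u ∈ I, and sin(2α(v)) ≠ 0 for every v ∈ J. Assume that for all u ∈ I and v ∈ J: (i) sin(2α(v))·ρ(u)·( λ₂'(u) − λ₁'(u) + 2α'(v)·(λ₁(u) − λ₂(u)) ) = 0 and (ii) λ₁'(u)·sin²(α(v)) + λ₂'(u)·cos²(α(v)) + ((λ₁(u) − λ₂(u))/ρ(u))·cos(2α(v))·(ρ(u)·α'(v) − ρ'(u)) = 0. Then either α is constant on J and λ₂ − λ₁ is constant on I, or ρ' is identically zero on I. -/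
noncomputable section

open Real

theorem const_aux_s8 (J : Set ℝ) (hne : J.Nonempty) (ho : IsOpen J) (hc : J.OrdConnected)
    (f : ℝ → ℝ) (hf : ∀ v ∈ J, HasDerivAt f 0 v) : ∃ c : ℝ, ∀ v ∈ J, f v = c := by
  obtain ⟨x, hx⟩ := hne
  refine ⟨f x, fun v hv => ?_⟩
  exact ho.is_const_of_deriv_eq_zero hc.isPreconnected
    (fun w hw => (hf w hw).differentiableAt.differentiableWithinAt)
    (fun w hw => (hf w hw).deriv) hv hx

/-- Analytic core of the mixed-case theorem: for a timelike intrinsic rotational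
surface whose Weingarten endomorphism has the Euclidean-rotation form, with no
umbilic points and `sin(2α) ≠ 0` on `J`, the Codazzi equations force either `α`
constant and the skew curvature `λ₂ − λ₁` constant, or `ρ' ≡ 0`. -/
theorem stmt8 (I J : Set ℝ)
    (hIne : I.Nonempty) (hIopen : IsOpen I) (hIconn : I.OrdConnected)
    (hJne : J.Nonempty) (hJopen : IsOpen J) (hJconn : J.OrdConnected)
    (ρ ρ' lam₁ lam₁' lam₂ lam₂' α α' : ℝ → ℝ)
    (hρ : ∀ u ∈ I, HasDerivAt ρ (ρ' u) u)
    (hl₁ : ∀ u ∈ I, HasDerivAt lam₁ (lam₁' u) u)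
    (hl₂ : ∀ u ∈ I, HasDerivAt lam₂ (lam₂' u) u)
    (hα : ∀ v ∈ J, HasDerivAt α (α' v) v)
    (hpos : ∀ u ∈ I, 0 < ρ u)
    (humb : ∀ u ∈ I, lam₁ u ≠ lam₂ u)
    (hsin : ∀ v ∈ J, Real.sin (2 * α v) ≠ 0)
    (hcod1 : ∀ u ∈ I, ∀ v ∈ J,
      Real.sin (2 * α v) * ρ u *
        (lam₂' u - lam₁' u + 2 * α' v * (lam₁ u - lam₂ u)) = 0)
    (hcod2 : ∀ u ∈ I, ∀ v ∈ J,
      lam₁' u * Real.sin (α v) ^ 2 + lam₂' u * Real.cos (α v) ^ 2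
        + (lam₁ u - lam₂ u) / ρ u * Real.cos (2 * α v)
          * (ρ u * α' v - ρ' u) = 0) :
    ((∃ c : ℝ, ∀ v ∈ J, α v = c) ∧ (∃ k : ℝ, ∀ u ∈ I, lam₂ u - lam₁ u = k)) ∨
    (∀ u ∈ I, ρ' u = 0) := by
  have h1 : ∀ u ∈ I, ∀ v ∈ J, lam₂' u - lam₁' u = 2 * α' v * (lam₂ u - lam₁ u) := by
    intro u hu v hv
    have h := hcod1 u hu v hv
    rcases mul_eq_zero.mp h with h | h
    · exact absurd h (mul_ne_zero (hsin v hv) (hpos u hu).ne')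
    · linarith
  obtain ⟨u₀, hu₀⟩ := hIne
  obtain ⟨v₀, hv₀⟩ := hJne
  have ha : ∀ v ∈ J, α' v = α' v₀ := by
    intro v hv
    have e1 := h1 u₀ hu₀ v hv
    have e2 := h1 u₀ hu₀ v₀ hv₀
    have hD : lam₂ u₀ - lam₁ u₀ ≠ 0 := sub_ne_zero.mpr (humb u₀ hu₀).symm
    apply mul_right_cancel₀ hD
    linarith
  by_cases h0 : α' v₀ = 0
  · left
    refine ⟨const_aux_s8 J ⟨v₀, hv₀⟩ hJopen hJconn α fun v hv => ?_,
      const_aux_s8 I ⟨u₀, hu₀⟩ hIopen hIconn (fun u => lam₂ u - lam₁ u) fun u hu => ?_⟩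
    · have h := hα v hv
      rwa [ha v hv, h0] at h
    · have h := (hl₂ u hu).sub (hl₁ u hu)
      rw [h1 u hu v₀ hv₀, h0, mul_zero, zero_mul] at h
      exact h
  · right
    intro u hu
    by_contra hr
    have hD : lam₂ u - lam₁ u ≠ 0 := sub_ne_zero.mpr (humb u hu).symm
    have hρ0 : ρ u ≠ 0 := (hpos u hu).ne'
    have key : ∀ v ∈ J, Real.cos (2 * α v) * ((lam₂ u - lam₁ u) * ρ' u)
        = - ((lam₁' u + lam₂' u) / 2 * ρ u) := by
      intro v hv
      have h := hcod2 u hu v hv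
      have e := h1 u hu v hv
      rw [Real.sin_sq, Real.cos_sq] at h
      field_simp at h
      linear_combination h / 2 - Real.cos (2 * α v) * ρ u / 2 * e
    have hK : (lam₂ u - lam₁ u) * ρ' u ≠ 0 := mul_ne_zero hD hr
    have hconst : (fun v => Real.cos (2 * α v)) =ᶠ[nhds v₀]
        fun _ => Real.cos (2 * α v₀) := by
      filter_upwards [hJopen.mem_nhds hv₀] with v hv
      apply mul_right_cancel₀ hK
      rw [key v hv, key v₀ hv₀]
    have d1 := ((hα v₀ hv₀).const_mul 2).cos
    have d2 := (hasDerivAt_const v₀ (Real.cos (2 * α v₀))).congr_of_eventuallyEq hconst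
    have e := d1.unique d2
    exact mul_ne_zero (neg_ne_zero.mpr (hsin v₀ hv₀)) (mul_ne_zero two_ne_zero h0) e
end
end

section
/- Let I ⊆ ℝ be a nonempty open interval and a, h ∈ ℝ. Let ρ, λ₁ : I → ℝ be differentiable with ρ(u) > 0 for all u ∈ I, and suppose that −ρ(u)·λ₁'(u) + 2·(λ₁(u) + h)·(a·ρ(u) − ρ'(u)) = 0 for all u ∈ I. Then there exists a constant b ∈ ℝ such that λ₁(u) = −h + b·e^{2au}/ρ(u)² for all u ∈ I. -/
noncomputable section

open Real

/-- Integration step of Corollary `coh`: the solutions of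
`−ρλ₁' + 2(λ₁ + h)(aρ − ρ') = 0` on a nonempty open interval where `ρ > 0` are
`λ₁(u) = −h + b·e^{2au}/ρ(u)²`. -/
theorem stmt9 (I : Set ℝ) (hne : I.Nonempty) (hopen : IsOpen I)
    (hconn : I.OrdConnected) (a h : ℝ) (ρ ρ' lam₁ lam₁' : ℝ → ℝ)
    (hρ : ∀ u ∈ I, HasDerivAt ρ (ρ' u) u)
    (hl : ∀ u ∈ I, HasDerivAt lam₁ (lam₁' u) u)
    (hpos : ∀ u ∈ I, 0 < ρ u)
    (hode : ∀ u ∈ I,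
      -(ρ u * lam₁' u) + 2 * (lam₁ u + h) * (a * ρ u - ρ' u) = 0) :
    ∃ b : ℝ, ∀ u ∈ I, lam₁ u = -h + b * Real.exp (2 * a * u) / (ρ u) ^ 2 := by
  have hF : ∀ u ∈ I, HasDerivAt
      (fun u => (lam₁ u + h) * (ρ u) ^ 2 * Real.exp (-(2 * a * u))) 0 u := by
    intro u hu
    have h1 : HasDerivAt (fun u : ℝ => Real.exp (-(2 * a * u)))
        (Real.exp (-(2 * a * u)) * (-(2 * a * 1))) u :=
      (((hasDerivAt_id u).const_mul (2 * a)).neg).exp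
    have h2 := ((((hl u hu).add_const h).mul ((hρ u hu).pow 2)).mul h1)
    refine h2.congr_deriv ?_
    simp only [Pi.mul_apply, Pi.pow_apply]
    push_cast
    linear_combination (-(ρ u) * Real.exp (-(2 * a * u))) * hode u hu
  obtain ⟨b, hb⟩ := hopen.exists_is_const_of_deriv_eq_zero hconn.isPreconnected
    (fun u hu => (hF u hu).differentiableAt.differentiableWithinAt)
    (fun u hu => (hF u hu).deriv)
  refine ⟨b, fun u hu => ?_⟩
  have h3 := hb u hu
  have hp := (hpos u hu).ne'
  have he : Real.exp (-(2 * a * u)) * Real.exp (2 * a * u) = 1 := by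
    rw [← Real.exp_add]; simp
  have h4 : b * Real.exp (2 * a * u) = (lam₁ u + h) * (ρ u) ^ 2 := by
    rw [← h3]
    linear_combination ((lam₁ u + h) * (ρ u) ^ 2) * he
  rw [h4, mul_div_assoc, div_self (pow_ne_zero 2 hp)]
  ring
end
end

section
/- Let a, A, B ∈ ℝ with a ≠ 0, A > 0, B ≠ 0, B ≠ 2a and B ≠ −2a. Define X : ℝ² → ℝ³ by X(u,v) = ( e^{(2a−B)u}·(A²(2a−B)e^{2Bu}·cos((2a+B)v) + (2a+B)·cos((2a−B)v)) / (2AB(4a² − B²)) , e^{(2a−B)u}·((2a+B)·sin((2a−B)v) − A²(2a−B)e^{2Bu}·sin((2a+B)v)) / (2AB(4a² − B²)) , e^{2au}·cos(2av)/(2aB) ). Then for all (u,v) ∈ ℝ²: ⟨X_u, X_u⟩ = ⟨X_v, X_v⟩ = e^{(4a−2B)u}(A²e^{2Bu} − 1)²/(4A²B²), ⟨X_u, X_v⟩ = 0, and X_{uu} + X_{vv} = 0. In particular, wherever A²e^{2Bu} ≠ 1, X is a conformally parametrized spacelike surface with zero mean curvature and first fundamental form e^{(4a−2B)u}(A²e^{2Bu}−1)²/(4A²B²)·(du²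 + dv²). -/
noncomputable section

open Real

/-- The spacelike intrinsic rotational ZMC surface with twist `α(v) = av`,
generic case `B ≠ ±2a`. -/
def XS (a A B : ℝ) (u v : ℝ) : ℝ × ℝ × ℝ :=
  (Real.exp ((2 * a - B) * u) *
      (A ^ 2 * (2 * a - B) * Real.exp (2 * B * u) * Real.cos ((2 * a + B) * v)
        + (2 * a + B) * Real.cos ((2 * a - B) * v)) / (2 * A * B * (4 * a ^ 2 - B ^ 2)),
   Real.exp ((2 * a - B) * u) *
      ((2 * a + B) * Real.sin ((2 * a - B) * v)
        - A ^ 2 * (2 * a - B) * Real.exp (2 * B * u) * Real.sin ((2 * a + B) * v)) /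
      (2 * A * B * (4 * a ^ 2 - B ^ 2)),
   Real.exp (2 * a * u) * Real.cos (2 * a * v) / (2 * a * B))

lemma hu (c v u k : ℝ) : HasDerivAt (fun t => Real.exp (c * t) * k) (c * Real.exp (c * u) * k) u := by
  have h := (((hasDerivAt_id u).const_mul c).exp).mul_const k
  refine HasDerivAt.congr_deriv h ?_
  simp only [id]; ring

lemma hc (c v k : ℝ) : HasDerivAt (fun t => k * Real.cos (c * t)) (-(c * k * Real.sin (c * v))) v := by
  have h := (((hasDerivAt_id v).const_mul c).cos).const_mul k
  refine HasDerivAt.congr_deriv h ?_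
  simp only [id]; ring

lemma hs (c v k : ℝ) : HasDerivAt (fun t => k * Real.sin (c * t)) (c * k * Real.cos (c * v)) v := by
  have h := (((hasDerivAt_id v).const_mul c).sin).const_mul k
  refine HasDerivAt.congr_deriv h ?_
  simp only [id]; ring

/-- The general form of all maps involved. -/
def G (p q r a1 a2 b1 b2 c1 c2 d1 d2 e1 e2 : ℝ) (u v : ℝ) : ℝ × ℝ × ℝ :=
  (Real.exp (q * u) * (a1 * Real.cos (q * v) + a2 * Real.sin (q * v))
    + Real.exp (p * u) * (b1 * Real.cos (p * v) + b2 * Real.sin (p * v)),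
   Real.exp (q * u) * (c1 * Real.cos (q * v) + c2 * Real.sin (q * v))
    + Real.exp (p * u) * (d1 * Real.cos (p * v) + d2 * Real.sin (p * v)),
   Real.exp (r * u) * (e1 * Real.cos (r * v) + e2 * Real.sin (r * v)))

lemma pu_G (p q r a1 a2 b1 b2 c1 c2 d1 d2 e1 e2 : ℝ) :
    pu (G p q r a1 a2 b1 b2 c1 c2 d1 d2 e1 e2) =
      G p q r (q*a1) (q*a2) (p*b1) (p*b2) (q*c1) (q*c2) (p*d1) (p*d2) (r*e1) (r*e2) := by
  funext u v
  have h := ((hu q v u (a1 * Real.cos (q * v) + a2 * Real.sin (q * v))).add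
      (hu p v u (b1 * Real.cos (p * v) + b2 * Real.sin (p * v)))).prodMk
    (((hu q v u (c1 * Real.cos (q * v) + c2 * Real.sin (q * v))).add
      (hu p v u (d1 * Real.cos (p * v) + d2 * Real.sin (p * v)))).prodMk
      (hu r v u (e1 * Real.cos (r * v) + e2 * Real.sin (r * v))))
  refine Eq.trans h.deriv ?_
  simp only [G, Prod.mk.injEq]
  refine ⟨?_, ?_, ?_⟩ <;> ring

lemma hv (c v k x y : ℝ) : HasDerivAt (fun t => k * (x * Real.cos (c * t) + y * Real.sin (c * t)))
    (k * (c * y * Real.cos (c * v) + -(c * x) * Real.sin (c * v))) v := by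
  refine HasDerivAt.congr_deriv (((hc c v x).add (hs c v y)).const_mul k) ?_
  ring

lemma pv_G (p q r a1 a2 b1 b2 c1 c2 d1 d2 e1 e2 : ℝ) :
    pv (G p q r a1 a2 b1 b2 c1 c2 d1 d2 e1 e2) =
      G p q r (q*a2) (-(q*a1)) (p*b2) (-(p*b1)) (q*c2) (-(q*c1)) (p*d2) (-(p*d1))
        (r*e2) (-(r*e1)) := by
  funext u v
  exact (((hv q v _ a1 a2).add (hv p v _ b1 b2)).prodMk
    (((hv q v _ c1 c2).add (hv p v _ d1 d2)).prodMk (hv r v _ e1 e2))).deriv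

lemma XS_eq (a A B : ℝ) (ha : a ≠ 0) (hA : A ≠ 0) (hB : B ≠ 0)
    (h1 : 2 * a - B ≠ 0) (h2 : 2 * a + B ≠ 0) :
    XS a A B = G (2*a-B) (2*a+B) (2*a) (A / (2*B) / (2*a+B)) 0 (1/(2*A*B)/(2*a-B)) 0
      0 (-(A/(2*B)/(2*a+B))) 0 (1/(2*A*B)/(2*a-B)) (1/B/(2*a)) 0 := by
  funext u v
  have e : Real.exp ((2*a+B)*u) = Real.exp ((2*a-B)*u) * Real.exp (2*B*u) := by
    rw [← Real.exp_add]; congr 1; ring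
  have e4 : 4 * a ^ 2 - B ^ 2 = (2*a-B)*(2*a+B) := by ring
  simp only [XS, G, Prod.mk.injEq, e, e4]
  generalize Real.exp ((2*a-B)*u) = E
  generalize Real.exp (2*B*u) = F
  generalize Real.cos ((2*a-B)*v) = x1
  generalize Real.cos ((2*a+B)*v) = x2
  generalize Real.sin ((2*a-B)*v) = x3
  generalize Real.sin ((2*a+B)*v) = x4
  generalize 2*a-B = p at *
  generalize 2*a+B = q at *
  refine ⟨?_, ?_, ?_⟩ <;> field_simp <;> ring

/-- The surface `XS a A B` is conformal and harmonic with conformal factor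
`e^{(4a−2B)u}(A²e^{2Bu} − 1)²/(4A²B²)`, hence a spacelike zero mean curvature
surface wherever `A²e^{2Bu} ≠ 1`. -/
theorem stmt10 (a A B : ℝ) (ha : a ≠ 0) (hA : 0 < A) (hB : B ≠ 0)
    (hB1 : B ≠ 2 * a) (hB2 : B ≠ -(2 * a)) (u v : ℝ) :
    lint (pu (XS a A B) u v) (pu (XS a A B) u v)
        = Real.exp ((4 * a - 2 * B) * u) * (A ^ 2 * Real.exp (2 * B * u) - 1) ^ 2 /
          (4 * A ^ 2 * B ^ 2) ∧
    lint (pv (XS a A B) u v) (pv (XS a A B) u v)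
        = Real.exp ((4 * a - 2 * B) * u) * (A ^ 2 * Real.exp (2 * B * u) - 1) ^ 2 /
          (4 * A ^ 2 * B ^ 2) ∧
    lint (pu (XS a A B) u v) (pv (XS a A B) u v) = 0 ∧
    pu (pu (XS a A B)) u v + pv (pv (XS a A B)) u v = 0 := by
  have hA' := hA.ne'
  have h1 : 2 * a - B ≠ 0 := fun h => hB1 (by linarith)
  have h2 : 2 * a + B ≠ 0 := fun h => hB2 (by linarith)
  rw [XS_eq a A B ha hA' hB h1 h2]
  simp only [pu_G, pv_G]
  have e1 : Real.exp ((2*a+B)*u) = Real.exp ((2*a-B)*u) * Real.exp (B*u) ^ 2 := by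
    rw [← Real.exp_nat_mul, ← Real.exp_add]; congr 1; push_cast; ring
  have e2 : Real.exp (2*a*u) = Real.exp ((2*a-B)*u) * Real.exp (B*u) := by
    rw [← Real.exp_add]; congr 1; ring
  have e3 : Real.exp (2*B*u) = Real.exp (B*u) ^ 2 := by
    rw [← Real.exp_nat_mul]; congr 1; push_cast; ring
  have e4 : Real.exp ((4*a-2*B)*u) = Real.exp ((2*a-B)*u) ^ 2 := by
    rw [← Real.exp_nat_mul]; congr 1; push_cast; ring
  have r1 : (2*a+B)*(A / (2*B) / (2*a+B)) = A / (2*B) := by field_simp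
  have r2 : (2*a-B)*(1/(2*A*B)/(2*a-B)) = 1/(2*A*B) := by field_simp
  have r3 : (2*a)*(1/B/(2*a)) = 1/B := by field_simp
  have s1 := Real.sin_sq_add_cos_sq (2*a*v)
  have s2 := Real.sin_sq_add_cos_sq (B*v)
  refine ⟨?_, ?_, ?_, ?_⟩
  rotate_left 3
  · simp only [G, Prod.mk_add_mk, Prod.mk_eq_zero]
    refine ⟨?_, ?_, ?_⟩ <;> ring
  all_goals
    simp only [G, lint, mul_neg, mul_zero, neg_zero, r1, r2, r3, zero_mul, add_zero, zero_add]
    rw [e1, e2]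
    try rw [e3, e4]
    simp only [sub_mul (2*a) B v, add_mul (2*a) B v, Real.cos_sub, Real.cos_add, Real.sin_sub,
      Real.sin_add]
    generalize Real.exp ((2*a-B)*u) = E
    generalize Real.exp (B*u) = F
    generalize Real.cos (2*a*v) = x at *
    generalize Real.sin (2*a*v) = y at *
    generalize Real.cos (B*v) = z at *
    generalize Real.sin (B*v) = w at *
    have hy : y^2 = 1 - x^2 := by linarith
    have hw : w^2 = 1 - z^2 := by linarith
    field_simp
    ring_nf
    try simp only [hy, hw]
    try ring
end
end

section
/- Let a, A ∈ ℝ with a ≠ 0 and A > 0. Define X : ℝ² → ℝ³ by X(u,v) = ( (A²e^{4au}·cos(4av) + 4au)/(16a²A) , (4av − A²e^{4au}·sin(4av))/(16a²A) , e^{2au}·cos(2av)/(4a²) ). Then for all (u,v) ∈ ℝ²: ⟨X_u, X_u⟩ = ⟨X_v, X_v⟩ = (A²e^{4au} − 1)²/(16a²A²), ⟨X_u, X_v⟩ = 0, and X_{uu} + X_{vv} = 0. In particular, for u ≠ −log(A)/(2a), X is a conformally parametrized spacelike surface with zero mean curvature and first fundamental form (A²e^{4au}−1)²/(16a²A²)·(du²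 + dv²). -/
noncomputable section

open Real

/-- The spacelike intrinsic rotational ZMC surface with twist `α(v) = av`,
resonant case `B = 2a`. -/
def XS2 (a A : ℝ) (u v : ℝ) : ℝ × ℝ × ℝ :=
  ((A ^ 2 * Real.exp (4 * a * u) * Real.cos (4 * a * v) + 4 * a * u) /
      (16 * a ^ 2 * A),
   (4 * a * v - A ^ 2 * Real.exp (4 * a * u) * Real.sin (4 * a * v)) /
      (16 * a ^ 2 * A),
   Real.exp (2 * a * u) * Real.cos (2 * a * v) / (4 * a ^ 2))

lemma hd_lin (k t : ℝ) : HasDerivAt (fun t : ℝ => k * t) k t := by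
  simpa using (hasDerivAt_id t).const_mul k

lemma hd_exp (k t : ℝ) : HasDerivAt (fun t : ℝ => Real.exp (k * t)) (Real.exp (k * t) * k) t :=
  (hd_lin k t).exp

lemma hd_cos (k t : ℝ) : HasDerivAt (fun t : ℝ => Real.cos (k * t)) (-Real.sin (k * t) * k) t :=
  (hd_lin k t).cos

lemma hd_sin (k t : ℝ) : HasDerivAt (fun t : ℝ => Real.sin (k * t)) (Real.cos (k * t) * k) t :=
  (hd_lin k t).sin

lemma pu_XS2 (a A : ℝ) (ha : a ≠ 0) (hA : 0 < A) : pu (XS2 a A) = fun u v =>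
    ((A ^ 2 * Real.exp (4 * a * u) * Real.cos (4 * a * v) + 1) / (4 * a * A),
     (-(A ^ 2 * Real.exp (4 * a * u) * Real.sin (4 * a * v))) / (4 * a * A),
     Real.exp (2 * a * u) * Real.cos (2 * a * v) / (2 * a)) := by
  have hA' := hA.ne'
  funext u v
  refine HasDerivAt.deriv (HasDerivAt.prodMk ?_ (HasDerivAt.prodMk ?_ ?_))
  · refine (((((hd_exp (4 * a) u).const_mul (A ^ 2)).mul_const _).add
      (hd_lin (4 * a) u)).div_const _).congr_deriv ?_
    field_simp
    ring
  · refine (((((hd_exp (4 * a) u).const_mul (A ^ 2)).mul_const _).const_sub _).div_const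
      _).congr_deriv ?_
    field_simp
    ring
  · refine (((hd_exp (2 * a) u).mul_const _).div_const _).congr_deriv ?_
    field_simp
    ring

lemma pv_XS2 (a A : ℝ) (ha : a ≠ 0) (hA : 0 < A) : pv (XS2 a A) = fun u v =>
    ((-(A ^ 2 * Real.exp (4 * a * u) * Real.sin (4 * a * v))) / (4 * a * A),
     (1 - A ^ 2 * Real.exp (4 * a * u) * Real.cos (4 * a * v)) / (4 * a * A),
     -(Real.exp (2 * a * u) * Real.sin (2 * a * v)) / (2 * a)) := by
  have hA' := hA.ne'
  funext u v
  refine HasDerivAt.deriv (HasDerivAt.prodMk ?_ (HasDerivAt.prodMk ?_ ?_))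
  · refine ((((hd_cos (4 * a) v).const_mul _).add_const _).div_const _).congr_deriv ?_
    field_simp
    ring
  · refine (((hd_lin (4 * a) v).sub ((hd_sin (4 * a) v).const_mul _)).div_const
      _).congr_deriv ?_
    field_simp
    ring
  · refine (((hd_cos (2 * a) v).const_mul _).div_const _).congr_deriv ?_
    field_simp
    ring

lemma puu_XS2 (a A : ℝ) (ha : a ≠ 0) (hA : 0 < A) (u v : ℝ) : pu (pu (XS2 a A)) u v =
    (A * Real.exp (4 * a * u) * Real.cos (4 * a * v),
     -(A * Real.exp (4 * a * u) * Real.sin (4 * a * v)),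
     Real.exp (2 * a * u) * Real.cos (2 * a * v)) := by
  have hA' := hA.ne'
  rw [pu_XS2 a A ha hA]
  refine HasDerivAt.deriv (HasDerivAt.prodMk ?_ (HasDerivAt.prodMk ?_ ?_))
  · refine (((((hd_exp (4 * a) u).const_mul (A ^ 2)).mul_const _).add_const
      _).div_const _).congr_deriv ?_
    field_simp
  · refine (((((hd_exp (4 * a) u).const_mul (A ^ 2)).mul_const _).neg).div_const
      _).congr_deriv ?_
    field_simp
  · refine (((hd_exp (2 * a) u).mul_const _).div_const _).congr_deriv ?_
    field_simp

lemma pvv_XS2 (a A : ℝ) (ha : a ≠ 0) (hA : 0 < A) (u v : ℝ) : pv (pv (XS2 a A)) u v =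
    (-(A * Real.exp (4 * a * u) * Real.cos (4 * a * v)),
     A * Real.exp (4 * a * u) * Real.sin (4 * a * v),
     -(Real.exp (2 * a * u) * Real.cos (2 * a * v))) := by
  have hA' := hA.ne'
  rw [pv_XS2 a A ha hA]
  refine HasDerivAt.deriv (HasDerivAt.prodMk ?_ (HasDerivAt.prodMk ?_ ?_))
  · refine ((((hd_sin (4 * a) v).const_mul _).neg).div_const _).congr_deriv ?_
    field_simp
  · refine ((((hd_cos (4 * a) v).const_mul _).const_sub _).div_const _).congr_deriv ?_
    field_simp
  · refine ((((hd_sin (2 * a) v).const_mul _).neg).div_const _).congr_deriv ?_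
    field_simp

/-- The surface `XS2 a A` is conformal and harmonic with conformal factor
`(A²e^{4au} − 1)²/(16a²A²)`, hence a spacelike zero mean curvature surface
wherever `u ≠ −log A/(2a)`. -/
theorem stmt11 (a A : ℝ) (ha : a ≠ 0) (hA : 0 < A) (u v : ℝ) :
    lint (pu (XS2 a A) u v) (pu (XS2 a A) u v)
        = (A ^ 2 * Real.exp (4 * a * u) - 1) ^ 2 / (16 * a ^ 2 * A ^ 2) ∧
    lint (pv (XS2 a A) u v) (pv (XS2 a A) u v)
        = (A ^ 2 * Real.exp (4 * a * u) - 1) ^ 2 / (16 * a ^ 2 * A ^ 2) ∧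
    lint (pu (XS2 a A) u v) (pv (XS2 a A) u v) = 0 ∧
    pu (pu (XS2 a A)) u v + pv (pv (XS2 a A)) u v = 0 := by
  have hA' := hA.ne'
  rw [puu_XS2 a A ha hA, pvv_XS2 a A ha hA, pu_XS2 a A ha hA, pv_XS2 a A ha hA]
  have hE : Real.exp (4 * a * u) = Real.exp (2 * a * u) ^ 2 := by
    rw [← Real.exp_nat_mul]; congr 1; push_cast; ring
  have hc : Real.cos (4 * a * v) = 2 * Real.cos (2 * a * v) ^ 2 - 1 := by
    rw [← Real.cos_two_mul]; congr 1; ring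
  have hs : Real.sin (4 * a * v) = 2 * Real.sin (2 * a * v) * Real.cos (2 * a * v) := by
    rw [← Real.sin_two_mul]; congr 1; ring
  have h1 : Real.sin (2 * a * v) ^ 2 = 1 - Real.cos (2 * a * v) ^ 2 := by
    rw [← Real.cos_sq_add_sin_sq (2 * a * v)]; ring
  simp only [lint, hE, hc, hs]
  generalize Real.exp (2 * a * u) = e
  generalize Real.cos (2 * a * v) = c at *
  generalize Real.sin (2 * a * v) = s at *
  refine ⟨?_, ?_, ?_, ?_⟩
  · field_simp
    ring_nf
    rw [h1]
    ring
  · field_simp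
    ring_nf
    rw [h1]
    ring
  · field_simp
    ring
  · ext <;> simp
end
end

section
/- Let a, A ∈ ℝ with a ≠ 0 and A > 0. Define X : ℝ² → ℝ³ by X(u,v) = ( −e^{4au}·cos(4av)/(16a²A) − Au/(4a) , Av/(4a) − e^{4au}·sin(4av)/(16a²A) , −e^{2au}·cos(2av)/(4a²) ). Then for all (u,v) ∈ ℝ²: ⟨X_u, X_u⟩ = ⟨X_v, X_v⟩ = (A² − e^{4au})²/(16a²A²), ⟨X_u, X_v⟩ = 0, and X_{uu} + X_{vv} = 0. In particular, for u ≠ log(A)/(2a), X is a conformally parametrized spacelike surface with zero mean curvature and first fundamental form (A² − e^{4au})²/(16a²A²)·(du² + dv²). -/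
noncomputable section

open Real

/-- The spacelike intrinsic rotational ZMC surface with twist `α(v) = av`,
resonant case `B = −2a`. -/
def XS3 (a A : ℝ) (u v : ℝ) : ℝ × ℝ × ℝ :=
  (-(Real.exp (4 * a * u) * Real.cos (4 * a * v)) / (16 * a ^ 2 * A)
      - A * u / (4 * a),
   A * v / (4 * a)
      - Real.exp (4 * a * u) * Real.sin (4 * a * v) / (16 * a ^ 2 * A),
   -(Real.exp (2 * a * u) * Real.cos (2 * a * v)) / (4 * a ^ 2))

lemma hexp_lin (k t : ℝ) : HasDerivAt (fun t => Real.exp (k * t)) (Real.exp (k * t) * k) t := by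
  simpa using ((hasDerivAt_id t).const_mul k).exp

lemma hcos_lin (k t : ℝ) : HasDerivAt (fun t => Real.cos (k * t)) (-Real.sin (k * t) * k) t := by
  simpa using ((hasDerivAt_id t).const_mul k).cos

lemma hsin_lin (k t : ℝ) : HasDerivAt (fun t => Real.sin (k * t)) (Real.cos (k * t) * k) t := by
  simpa using ((hasDerivAt_id t).const_mul k).sin

lemma pu_XS3 (a A : ℝ) (ha : a ≠ 0) (hA : 0 < A) : pu (XS3 a A) = fun u v =>
    (-(Real.exp (4 * a * u) * Real.cos (4 * a * v)) / (4 * a * A) - A / (4 * a),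
     -(Real.exp (4 * a * u) * Real.sin (4 * a * v)) / (4 * a * A),
     -(Real.exp (2 * a * u) * Real.cos (2 * a * v)) / (2 * a)) := by
  funext u v
  have hA' := hA.ne'
  refine HasDerivAt.deriv (HasDerivAt.prodMk ?_ (HasDerivAt.prodMk ?_ ?_))
  · refine HasDerivAt.congr_deriv ((((hexp_lin (4 * a) u).mul_const _).neg.div_const _).sub
      (((hasDerivAt_id u).const_mul A).div_const _)) ?_
    field_simp
    ring
  · refine HasDerivAt.congr_deriv ((((hexp_lin (4 * a) u).mul_const _).div_const _).const_sub _) ?_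
    field_simp
    ring
  · refine HasDerivAt.congr_deriv (((hexp_lin (2 * a) u).mul_const _).neg.div_const _) ?_
    field_simp
    ring

lemma pv_XS3 (a A : ℝ) (ha : a ≠ 0) (hA : 0 < A) : pv (XS3 a A) = fun u v =>
    (Real.exp (4 * a * u) * Real.sin (4 * a * v) / (4 * a * A),
     A / (4 * a) - Real.exp (4 * a * u) * Real.cos (4 * a * v) / (4 * a * A),
     Real.exp (2 * a * u) * Real.sin (2 * a * v) / (2 * a)) := by
  funext u v
  have hA' := hA.ne'
  refine HasDerivAt.deriv (HasDerivAt.prodMk ?_ (HasDerivAt.prodMk ?_ ?_))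
  · refine HasDerivAt.congr_deriv
      ((((hcos_lin (4 * a) v).const_mul _).neg.div_const _).sub_const _) ?_
    field_simp
    ring
  · refine HasDerivAt.congr_deriv ((((hasDerivAt_id v).const_mul A).div_const _).sub
      (((hsin_lin (4 * a) v).const_mul _).div_const _)) ?_
    field_simp
    try ring
  · refine HasDerivAt.congr_deriv (((hcos_lin (2 * a) v).const_mul _).neg.div_const _) ?_
    field_simp
    ring

lemma puu_XS3 (a A : ℝ) (ha : a ≠ 0) (hA : 0 < A) (u v : ℝ) : pu (pu (XS3 a A)) u v =
    (-(Real.exp (4 * a * u) * Real.cos (4 * a * v)) / A,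
     -(Real.exp (4 * a * u) * Real.sin (4 * a * v)) / A,
     -(Real.exp (2 * a * u) * Real.cos (2 * a * v))) := by
  rw [pu_XS3 a A ha hA]
  have hA' := hA.ne'
  refine HasDerivAt.deriv (HasDerivAt.prodMk ?_ (HasDerivAt.prodMk ?_ ?_))
  · refine HasDerivAt.congr_deriv
      ((((hexp_lin (4 * a) u).mul_const _).neg.div_const _).sub_const _) ?_
    field_simp
  · refine HasDerivAt.congr_deriv (((hexp_lin (4 * a) u).mul_const _).neg.div_const _) ?_
    field_simp
  · refine HasDerivAt.congr_deriv (((hexp_lin (2 * a) u).mul_const _).neg.div_const _) ?_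
    field_simp

lemma pvv_XS3 (a A : ℝ) (ha : a ≠ 0) (hA : 0 < A) (u v : ℝ) : pv (pv (XS3 a A)) u v =
    (Real.exp (4 * a * u) * Real.cos (4 * a * v) / A,
     Real.exp (4 * a * u) * Real.sin (4 * a * v) / A,
     Real.exp (2 * a * u) * Real.cos (2 * a * v)) := by
  rw [pv_XS3 a A ha hA]
  have hA' := hA.ne'
  refine HasDerivAt.deriv (HasDerivAt.prodMk ?_ (HasDerivAt.prodMk ?_ ?_))
  · refine HasDerivAt.congr_deriv (((hsin_lin (4 * a) v).const_mul _).div_const _) ?_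
    field_simp
  · refine HasDerivAt.congr_deriv
      ((((hcos_lin (4 * a) v).const_mul _).div_const _).const_sub _) ?_
    field_simp
  · refine HasDerivAt.congr_deriv (((hsin_lin (2 * a) v).const_mul _).div_const _) ?_
    field_simp

/-- The surface `XS3 a A` is conformal and harmonic with conformal factor
`(A² − e^{4au})²/(16a²A²)`, hence a spacelike zero mean curvature surface
wherever `u ≠ log A/(2a)`. -/
theorem stmt12 (a A : ℝ) (ha : a ≠ 0) (hA : 0 < A) (u v : ℝ) :
    lint (pu (XS3 a A) u v) (pu (XS3 a A) u v)
        = (A ^ 2 - Real.exp (4 * a * u)) ^ 2 / (16 * a ^ 2 * A ^ 2) ∧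
    lint (pv (XS3 a A) u v) (pv (XS3 a A) u v)
        = (A ^ 2 - Real.exp (4 * a * u)) ^ 2 / (16 * a ^ 2 * A ^ 2) ∧
    lint (pu (XS3 a A) u v) (pv (XS3 a A) u v) = 0 ∧
    pu (pu (XS3 a A)) u v + pv (pv (XS3 a A)) u v = 0 := by
  have hA' := hA.ne'
  have hE : Real.exp (4 * a * u) = Real.exp (2 * a * u) ^ 2 := by
    rw [← Real.exp_nat_mul]; congr 1; push_cast; ring
  have hC : Real.cos (4 * a * v) = 2 * Real.cos (2 * a * v) ^ 2 - 1 := by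
    rw [← Real.cos_two_mul]; congr 1; ring
  have hS : Real.sin (4 * a * v) = 2 * Real.sin (2 * a * v) * Real.cos (2 * a * v) := by
    rw [← Real.sin_two_mul]; congr 1; ring
  have h1 : Real.sin (2 * a * v) ^ 2 = 1 - Real.cos (2 * a * v) ^ 2 := Real.sin_sq _
  rw [puu_XS3 a A ha hA, pvv_XS3 a A ha hA, pu_XS3 a A ha hA, pv_XS3 a A ha hA]
  simp only [lint, hE, hC, hS]
  generalize Real.exp (2 * a * u) = E
  generalize Real.sin (2 * a * v) = s at *
  generalize Real.cos (2 * a * v) = c at *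
  refine ⟨?_, ?_, ?_, ?_⟩
  · field_simp
    ring_nf
    simp only [h1]
    ring
  · field_simp
    ring_nf
    simp only [h1]
    ring
  · field_simp
    ring
  · ext <;> simp <;> ring
end
end

section
/- Let a, A, B ∈ ℝ with a ≠ 0, A > 0, B ≠ 0, B ≠ 2a and B ≠ −2a. Define X : ℝ² → ℝ³ by X(u,v) = ( e^{2au}·cosh(2av)/(2aB) , e^{(2a−B)u}·((2a+B)·cosh((2a−B)v) − A²(2a−B)e^{2Bu}·cosh((2a+B)v)) / (2AB(4a² − B²)) , −e^{(2a−B)u}·(A²(2a−B)e^{2Bu}·sinh((2a+B)v) + (2a+B)·sinh((2a−B)v)) / (2AB(4a² − B²)) ). Then for all (u,v) ∈ ℝ²: ⟨X_u, X_u⟩ = e^{(4a−2B)u}(A²e^{2Bu} + 1)²/(4A²B²), ⟨X_v, X_v⟩ = −e^{(4a−2B)u}(A²e^{2Bu} + 1)²/(4A²B²), ⟨X_u, X_v⟩ = 0, and X_{uu} − X_{vv} = 0. In particular, X is a timelike zero mean curvature surface with first fundamental form e^{(4a−2B)u}(A²e^{2Bu}+1)²/(4A²B²)·(du² − dv²).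 -/
noncomputable section

open Real

/-- The timelike intrinsic rotational ZMC surface with twist `α(v) = av`,
signature pattern `δ = −ε = 1`, generic case `B ≠ ±2a`. -/
def XT (a A B : ℝ) (u v : ℝ) : ℝ × ℝ × ℝ :=
  (Real.exp (2 * a * u) * Real.cosh (2 * a * v) / (2 * a * B),
   Real.exp ((2 * a - B) * u) *
      ((2 * a + B) * Real.cosh ((2 * a - B) * v)
        - A ^ 2 * (2 * a - B) * Real.exp (2 * B * u) * Real.cosh ((2 * a + B) * v)) /
      (2 * A * B * (4 * a ^ 2 - B ^ 2)),
   -(Real.exp ((2 * a - B) * u) *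
      (A ^ 2 * (2 * a - B) * Real.exp (2 * B * u) * Real.sinh ((2 * a + B) * v)
        + (2 * a + B) * Real.sinh ((2 * a - B) * v)) /
      (2 * A * B * (4 * a ^ 2 - B ^ 2))))

/-- A normal form: three exponential-hyperbolic terms with free coefficients. -/
def NF (a B c1 c2 c3 c4 c5 : ℝ) (f g : ℝ → ℝ) (u v : ℝ) : ℝ × ℝ × ℝ :=
  (c1 * (exp (2 * a * u) * f (2 * a * v)),
   c2 * (exp ((2 * a - B) * u) * f ((2 * a - B) * v))
     + c3 * (exp ((2 * a + B) * u) * f ((2 * a + B) * v)),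
   c4 * (exp ((2 * a - B) * u) * g ((2 * a - B) * v))
     + c5 * (exp ((2 * a + B) * u) * g ((2 * a + B) * v)))

lemma hasDeriv_exp_term (k c u : ℝ) :
    HasDerivAt (fun t => exp (k * t) * c) (k * (exp (k * u) * c)) u := by
  have h := (((hasDerivAt_id u).const_mul k).exp).mul_const c
  refine h.congr_deriv ?_
  simp only [id]
  ring

lemma hasDeriv_hyp_term (k c v : ℝ) (f f' : ℝ → ℝ) (hf : ∀ x, HasDerivAt f (f' x) x) :
    HasDerivAt (fun t => c * f (k * t)) (k * (c * f' (k * v))) v := by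
  have h := ((hf (k * v)).comp v ((hasDerivAt_id v).const_mul k)).const_mul c
  refine h.congr_deriv ?_
  ring

lemma pu_NF (a B c1 c2 c3 c4 c5 : ℝ) (f g : ℝ → ℝ) :
    pu (NF a B c1 c2 c3 c4 c5 f g) =
      NF a B (c1 * (2 * a)) (c2 * (2 * a - B)) (c3 * (2 * a + B))
        (c4 * (2 * a - B)) (c5 * (2 * a + B)) f g := by
  funext u v
  refine HasDerivAt.deriv ?_
  have h := ((hasDeriv_exp_term (2 * a) (f (2 * a * v)) u).const_mul c1).prodMk
    ((((hasDeriv_exp_term (2 * a - B) (f ((2 * a - B) * v)) u).const_mul c2).add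
      ((hasDeriv_exp_term (2 * a + B) (f ((2 * a + B) * v)) u).const_mul c3)).prodMk
     (((hasDeriv_exp_term (2 * a - B) (g ((2 * a - B) * v)) u).const_mul c4).add
      ((hasDeriv_exp_term (2 * a + B) (g ((2 * a + B) * v)) u).const_mul c5)))
  refine h.congr_deriv ?_
  simp only [NF, mul_assoc]

lemma pv_NF (a B c1 c2 c3 c4 c5 : ℝ) (f g f' g' : ℝ → ℝ)
    (hf : ∀ x, HasDerivAt f (f' x) x) (hg : ∀ x, HasDerivAt g (g' x) x) :
    pv (NF a B c1 c2 c3 c4 c5 f g) =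
      NF a B (c1 * (2 * a)) (c2 * (2 * a - B)) (c3 * (2 * a + B))
        (c4 * (2 * a - B)) (c5 * (2 * a + B)) f' g' := by
  funext u v
  refine HasDerivAt.deriv ?_
  have h := ((hasDeriv_hyp_term (2 * a) (exp (2 * a * u)) v f f' hf).const_mul c1).prodMk
    ((((hasDeriv_hyp_term (2 * a - B) (exp ((2 * a - B) * u)) v f f' hf).const_mul c2).add
      ((hasDeriv_hyp_term (2 * a + B) (exp ((2 * a + B) * u)) v f f' hf).const_mul c3)).prodMk
     (((hasDeriv_hyp_term (2 * a - B) (exp ((2 * a - B) * u)) v g g' hg).const_mul c4).add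
      ((hasDeriv_hyp_term (2 * a + B) (exp ((2 * a + B) * u)) v g g' hg).const_mul c5)))
  refine h.congr_deriv ?_
  simp only [NF, mul_assoc]

lemma XT_eq (a A B : ℝ) (ha : a ≠ 0) (hA : A ≠ 0) (hB : B ≠ 0)
    (hm : 2 * a - B ≠ 0) (hp : 2 * a + B ≠ 0) :
    XT a A B = NF a B (1 / (2 * a * B)) (1 / (2 * A * B * (2 * a - B)))
      (-(A / (2 * B * (2 * a + B)))) (-(1 / (2 * A * B * (2 * a - B))))
      (-(A / (2 * B * (2 * a + B)))) cosh sinh := by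
  funext u v
  have e : exp ((2 * a + B) * u) = exp ((2 * a - B) * u) * exp (2 * B * u) := by
    rw [← exp_add]; ring_nf
  have h4 : 4 * a ^ 2 - B ^ 2 = (2 * a - B) * (2 * a + B) := by ring
  simp only [XT, NF, e, h4]
  generalize exp ((2 * a - B) * u) = E
  generalize exp (2 * B * u) = F
  generalize cosh ((2 * a - B) * v) = x1
  generalize sinh ((2 * a - B) * v) = x2
  generalize cosh ((2 * a + B) * v) = x3
  generalize sinh ((2 * a + B) * v) = x4
  generalize hM : 2 * a - B = M at *
  generalize hP : 2 * a + B = P at *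
  refine Prod.ext ?_ (Prod.ext ?_ ?_)
  · simp only; ring
  · simp only; field_simp; ring
  · simp only; field_simp; ring

/-- The surface `XT a A B` is a paraconformal wave-harmonic parametrization, hence a
timelike zero mean curvature surface with first fundamental form
`e^{(4a−2B)u}(A²e^{2Bu}+1)²/(4A²B²)·(du² − dv²)`. -/
theorem stmt13 (a A B : ℝ) (ha : a ≠ 0) (hA : 0 < A) (hB : B ≠ 0)
    (hB1 : B ≠ 2 * a) (hB2 : B ≠ -(2 * a)) (u v : ℝ) :
    lint (pu (XT a A B) u v) (pu (XT a A B) u v)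
        = Real.exp ((4 * a - 2 * B) * u) * (A ^ 2 * Real.exp (2 * B * u) + 1) ^ 2 /
          (4 * A ^ 2 * B ^ 2) ∧
    lint (pv (XT a A B) u v) (pv (XT a A B) u v)
        = -(Real.exp ((4 * a - 2 * B) * u) * (A ^ 2 * Real.exp (2 * B * u) + 1) ^ 2 /
          (4 * A ^ 2 * B ^ 2)) ∧
    lint (pu (XT a A B) u v) (pv (XT a A B) u v) = 0 ∧
    pu (pu (XT a A B)) u v - pv (pv (XT a A B)) u v = 0 := by
  have hm : 2 * a - B ≠ 0 := fun h => hB1 (by linarith)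
  have hp : 2 * a + B ≠ 0 := fun h => hB2 (by linarith)
  have hA' : A ≠ 0 := hA.ne'
  rw [XT_eq a A B ha hA' hB hm hp]
  have c1 : 1 / (2 * a * B) * (2 * a) = 1 / B := by field_simp
  have c2 : 1 / (2 * A * B * (2 * a - B)) * (2 * a - B) = 1 / (2 * A * B) := by field_simp
  have c3 : -(A / (2 * B * (2 * a + B))) * (2 * a + B) = -(A / (2 * B)) := by field_simp
  have c4 : -(1 / (2 * A * B * (2 * a - B))) * (2 * a - B) = -(1 / (2 * A * B)) := by
    rw [neg_mul, c2]
  rw [pu_NF, pv_NF _ _ _ _ _ _ _ _ _ _ _ hasDerivAt_cosh hasDerivAt_sinh, pu_NF,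
    pv_NF _ _ _ _ _ _ _ _ _ _ _ hasDerivAt_sinh hasDerivAt_cosh, c1, c2, c3, c4]
  refine ⟨?_, ?_, ?_, sub_self _⟩
  all_goals
    simp only [NF, lint]
    have e1 : exp ((4 * a - 2 * B) * u) = exp ((2 * a - B) * u) ^ 2 := by
      rw [← exp_nat_mul]; push_cast; ring_nf
    have e2 : exp ((2 * a + B) * u) = exp ((2 * a - B) * u) * exp (B * u) ^ 2 := by
      rw [← exp_nat_mul, ← exp_add]; push_cast; ring_nf
    have e3 : exp (2 * a * u) = exp ((2 * a - B) * u) * exp (B * u) := by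
      rw [← exp_add]; ring_nf
    have e4 : exp (2 * B * u) = exp (B * u) ^ 2 := by
      rw [← exp_nat_mul]; push_cast; ring_nf
    have hv1 : (2 * a - B) * v = 2 * a * v - B * v := by ring
    have hv2 : (2 * a + B) * v = 2 * a * v + B * v := by ring
    rw [e2, e3, hv1, hv2, cosh_add, sinh_add, cosh_sub, sinh_sub]
    try rw [e1, e4]
    have q1 := cosh_sq (2 * a * v)
    have q2 := cosh_sq (B * v)
    generalize exp ((2 * a - B) * u) = E
    generalize exp (B * u) = F
    generalize cosh (2 * a * v) = x1 at *
    generalize sinh (2 * a * v) = x2 at *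
    generalize cosh (B * v) = x3 at *
    generalize sinh (B * v) = x4 at *
    field_simp
    ring_nf
    have q3 : x1 ^ 4 = (x2 ^ 2 + 1) ^ 2 := by rw [← q1]; ring
    have q4 : x3 ^ 4 = (x4 ^ 2 + 1) ^ 2 := by rw [← q2]; ring
    try simp only [q1, q2, q3, q4]
    try ring
end
end

section
/- Let a, A, B ∈ ℝ with a ≠ 0, A > 0, B ≠ 0, B ≠ 2a and B ≠ −2a. Define X : ℝ² → ℝ³ by X(u,v) = ( e^{2au}·cosh(2av)/(2aB) , −e^{(2a−B)u}·(A²(2a−B)e^{2Bu}·sinh((2a+B)v) − (2a+B)·sinh((2a−B)v)) / (2AB(4a² − B²)) , −e^{(2a−B)u}·((2a+B)·cosh((2a−B)v) + A²(2a−B)e^{2Bu}·cosh((2a+B)v)) / (2AB(4a² − B²)) ). Then for all (u,v) ∈ ℝ²: ⟨X_u, X_u⟩ = −e^{(4a−2B)u}(A²e^{2Bu} − 1)²/(4A²B²), ⟨X_v, X_v⟩ = e^{(4a−2B)u}(A²e^{2Bu} − 1)²/(4A²B²), ⟨X_u, X_v⟩ = 0, and X_{uu} − X_{vv} = 0. In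 particular, wherever A²e^{2Bu} ≠ 1, X is a timelike zero mean curvature surface with first fundamental form −e^{(4a−2B)u}(A²e^{2Bu}−1)²/(4A²B²)·(du² − dv²). -/
noncomputable section

open Real

/-- The timelike intrinsic rotational ZMC surface with twist `α(v) = av`,
signature pattern `δ = −ε = −1`, generic case `B ≠ ±2a`. -/
def XT3 (a A B : ℝ) (u v : ℝ) : ℝ × ℝ × ℝ :=
  (Real.exp (2 * a * u) * Real.cosh (2 * a * v) / (2 * a * B),
   -(Real.exp ((2 * a - B) * u) *
      (A ^ 2 * (2 * a - B) * Real.exp (2 * B * u) * Real.sinh ((2 * a + B) * v)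
        - (2 * a + B) * Real.sinh ((2 * a - B) * v)) /
      (2 * A * B * (4 * a ^ 2 - B ^ 2))),
   -(Real.exp ((2 * a - B) * u) *
      ((2 * a + B) * Real.cosh ((2 * a - B) * v)
        + A ^ 2 * (2 * a - B) * Real.exp (2 * B * u) * Real.cosh ((2 * a + B) * v)) /
      (2 * A * B * (4 * a ^ 2 - B ^ 2))))

def XTu (a A B : ℝ) (u v : ℝ) : ℝ × ℝ × ℝ :=
  (Real.exp (2 * a * u) * Real.cosh (2 * a * v) / B,
   -(A ^ 2 * Real.exp ((2 * a + B) * u) * Real.sinh ((2 * a + B) * v)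
        - Real.exp ((2 * a - B) * u) * Real.sinh ((2 * a - B) * v)) / (2 * A * B),
   -(A ^ 2 * Real.exp ((2 * a + B) * u) * Real.cosh ((2 * a + B) * v)
        + Real.exp ((2 * a - B) * u) * Real.cosh ((2 * a - B) * v)) / (2 * A * B))

def XTv (a A B : ℝ) (u v : ℝ) : ℝ × ℝ × ℝ :=
  (Real.exp (2 * a * u) * Real.sinh (2 * a * v) / B,
   -(A ^ 2 * Real.exp ((2 * a + B) * u) * Real.cosh ((2 * a + B) * v)
        - Real.exp ((2 * a - B) * u) * Real.cosh ((2 * a - B) * v)) / (2 * A * B),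
   -(A ^ 2 * Real.exp ((2 * a + B) * u) * Real.sinh ((2 * a + B) * v)
        + Real.exp ((2 * a - B) * u) * Real.sinh ((2 * a - B) * v)) / (2 * A * B))

def XTuu (a A B : ℝ) (u v : ℝ) : ℝ × ℝ × ℝ :=
  (2 * a * Real.exp (2 * a * u) * Real.cosh (2 * a * v) / B,
   -(A ^ 2 * (2 * a + B) * Real.exp ((2 * a + B) * u) * Real.sinh ((2 * a + B) * v)
        - (2 * a - B) * Real.exp ((2 * a - B) * u) * Real.sinh ((2 * a - B) * v)) / (2 * A * B),
   -(A ^ 2 * (2 * a + B) * Real.exp ((2 * a + B) * u) * Real.cosh ((2 * a + B) * v)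
        + (2 * a - B) * Real.exp ((2 * a - B) * u) * Real.cosh ((2 * a - B) * v)) / (2 * A * B))

lemma XT_exp (k u : ℝ) : HasDerivAt (fun t => Real.exp (k * t)) (k * Real.exp (k * u)) u := by
  have h := ((hasDerivAt_id u).const_mul k).exp
  simpa [mul_comm] using h

lemma XT_sinh (k u : ℝ) : HasDerivAt (fun t => Real.sinh (k * t)) (k * Real.cosh (k * u)) u := by
  have h := ((hasDerivAt_id u).const_mul k).sinh
  simpa [mul_comm] using h

lemma XT_cosh (k u : ℝ) : HasDerivAt (fun t => Real.cosh (k * t)) (k * Real.sinh (k * u)) u := by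
  have h := ((hasDerivAt_id u).const_mul k).cosh
  simpa [mul_comm] using h

/-- Normal form of the surface. -/
lemma XT3_eq (a A B : ℝ) (ha : a ≠ 0) (hA : A ≠ 0) (hB : B ≠ 0)
    (hp : 2 * a + B ≠ 0) (hq : 2 * a - B ≠ 0) : XT3 a A B = fun u v =>
  (Real.exp (2 * a * u) * Real.cosh (2 * a * v) / (2 * a * B),
   -(A ^ 2 * Real.exp ((2 * a + B) * u) * Real.sinh ((2 * a + B) * v) / (2 * a + B)
        - Real.exp ((2 * a - B) * u) * Real.sinh ((2 * a - B) * v) / (2 * a - B)) / (2 * A * B),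
   -(A ^ 2 * Real.exp ((2 * a + B) * u) * Real.cosh ((2 * a + B) * v) / (2 * a + B)
        + Real.exp ((2 * a - B) * u) * Real.cosh ((2 * a - B) * v) / (2 * a - B)) / (2 * A * B)) := by
  funext u v
  have e : Real.exp ((2 * a + B) * u) = Real.exp ((2 * a - B) * u) * Real.exp (2 * B * u) := by
    rw [← Real.exp_add]; congr 1; ring
  have d : 4 * a ^ 2 - B ^ 2 = (2 * a + B) * (2 * a - B) := by ring
  unfold XT3
  rw [e, d]
  refine Prod.ext rfl (Prod.ext ?_ ?_)
  · simp only
    field_simp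
  · simp only
    field_simp
    ring

lemma XT_pu (a A B : ℝ) (ha : a ≠ 0) (hA : A ≠ 0) (hB : B ≠ 0)
    (hp : 2 * a + B ≠ 0) (hq : 2 * a - B ≠ 0) : pu (XT3 a A B) = XTu a A B := by
  rw [XT3_eq a A B ha hA hB hp hq]
  funext u v
  refine HasDerivAt.deriv (HasDerivAt.prodMk ?_ (HasDerivAt.prodMk ?_ ?_))
  · refine HasDerivAt.congr_deriv (((XT_exp (2 * a) u).mul_const (Real.cosh (2 * a * v))).div_const (2 * a * B)) ?_
    field_simp
  · refine HasDerivAt.congr_deriv ((((((XT_exp (2 * a + B) u).const_mul (A ^ 2)).mul_const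
      (Real.sinh ((2 * a + B) * v))).div_const (2 * a + B)).sub
      (((XT_exp (2 * a - B) u).mul_const
      (Real.sinh ((2 * a - B) * v))).div_const (2 * a - B))).neg.div_const (2 * A * B)) ?_
    field_simp
  · refine HasDerivAt.congr_deriv ((((((XT_exp (2 * a + B) u).const_mul (A ^ 2)).mul_const
      (Real.cosh ((2 * a + B) * v))).div_const (2 * a + B)).add
      (((XT_exp (2 * a - B) u).mul_const
      (Real.cosh ((2 * a - B) * v))).div_const (2 * a - B))).neg.div_const (2 * A * B)) ?_
    field_simp

lemma XT_pv (a A B : ℝ) (ha : a ≠ 0) (hA : A ≠ 0) (hB : B ≠ 0)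
    (hp : 2 * a + B ≠ 0) (hq : 2 * a - B ≠ 0) : pv (XT3 a A B) = XTv a A B := by
  rw [XT3_eq a A B ha hA hB hp hq]
  funext u v
  refine HasDerivAt.deriv (HasDerivAt.prodMk ?_ (HasDerivAt.prodMk ?_ ?_))
  · refine HasDerivAt.congr_deriv (((XT_cosh (2 * a) v).const_mul (Real.exp (2 * a * u))).div_const (2 * a * B)) ?_
    field_simp
  · refine HasDerivAt.congr_deriv (((((XT_sinh (2 * a + B) v).const_mul (A ^ 2 * Real.exp ((2 * a + B) * u))).div_const
      (2 * a + B)).sub (((XT_sinh (2 * a - B) v).const_mul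
      (Real.exp ((2 * a - B) * u))).div_const (2 * a - B))).neg.div_const (2 * A * B)) ?_
    field_simp
  · refine HasDerivAt.congr_deriv (((((XT_cosh (2 * a + B) v).const_mul (A ^ 2 * Real.exp ((2 * a + B) * u))).div_const
      (2 * a + B)).add (((XT_cosh (2 * a - B) v).const_mul
      (Real.exp ((2 * a - B) * u))).div_const (2 * a - B))).neg.div_const (2 * A * B)) ?_
    field_simp

lemma XT_puu (a A B : ℝ) : pu (XTu a A B) = XTuu a A B := by
  funext u v
  refine HasDerivAt.deriv (HasDerivAt.prodMk ?_ (HasDerivAt.prodMk ?_ ?_))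
  · exact ((XT_exp (2 * a) u).mul_const (Real.cosh (2 * a * v))).div_const B
  · refine HasDerivAt.congr_deriv (((((XT_exp (2 * a + B) u).const_mul (A ^ 2)).mul_const
      (Real.sinh ((2 * a + B) * v))).sub
      ((XT_exp (2 * a - B) u).mul_const
      (Real.sinh ((2 * a - B) * v)))).neg.div_const (2 * A * B)) ?_
    ring
  · refine HasDerivAt.congr_deriv (((((XT_exp (2 * a + B) u).const_mul (A ^ 2)).mul_const
      (Real.cosh ((2 * a + B) * v))).add
      ((XT_exp (2 * a - B) u).mul_const
      (Real.cosh ((2 * a - B) * v)))).neg.div_const (2 * A * B)) ?_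
    ring

lemma XT_pvv (a A B : ℝ) : pv (XTv a A B) = XTuu a A B := by
  funext u v
  refine HasDerivAt.deriv (HasDerivAt.prodMk ?_ (HasDerivAt.prodMk ?_ ?_))
  · refine HasDerivAt.congr_deriv (((XT_sinh (2 * a) v).const_mul (Real.exp (2 * a * u))).div_const B) ?_
    ring
  · refine HasDerivAt.congr_deriv ((((XT_cosh (2 * a + B) v).const_mul (A ^ 2 * Real.exp ((2 * a + B) * u))).sub
      ((XT_cosh (2 * a - B) v).const_mul
      (Real.exp ((2 * a - B) * u)))).neg.div_const (2 * A * B)) ?_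
    ring
  · refine HasDerivAt.congr_deriv ((((XT_sinh (2 * a + B) v).const_mul (A ^ 2 * Real.exp ((2 * a + B) * u))).add
      ((XT_sinh (2 * a - B) v).const_mul
      (Real.exp ((2 * a - B) * u)))).neg.div_const (2 * A * B)) ?_
    ring

/-- The surface `XT3 a A B` is a wave-harmonic parametrization with
`⟨X_u,X_u⟩ = −⟨X_v,X_v⟩ = −e^{(4a−2B)u}(A²e^{2Bu}−1)²/(4A²B²)`, hence a timelike
zero mean curvature surface wherever `A²e^{2Bu} ≠ 1`. -/
theorem stmt15 (a A B : ℝ) (ha : a ≠ 0) (hA : 0 < A) (hB : B ≠ 0)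
    (hB1 : B ≠ 2 * a) (hB2 : B ≠ -(2 * a)) (u v : ℝ) :
    lint (pu (XT3 a A B) u v) (pu (XT3 a A B) u v)
        = -(Real.exp ((4 * a - 2 * B) * u) * (A ^ 2 * Real.exp (2 * B * u) - 1) ^ 2 /
          (4 * A ^ 2 * B ^ 2)) ∧
    lint (pv (XT3 a A B) u v) (pv (XT3 a A B) u v)
        = Real.exp ((4 * a - 2 * B) * u) * (A ^ 2 * Real.exp (2 * B * u) - 1) ^ 2 /
          (4 * A ^ 2 * B ^ 2) ∧
    lint (pu (XT3 a A B) u v) (pv (XT3 a A B) u v) = 0 ∧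
    pu (pu (XT3 a A B)) u v - pv (pv (XT3 a A B)) u v = 0 := by
  have hA0 : A ≠ 0 := hA.ne'
  have hp : 2 * a + B ≠ 0 := fun h => hB2 (by linarith)
  have hq : 2 * a - B ≠ 0 := fun h => hB1 (by linarith)
  rw [XT_pu a A B ha hA0 hB hp hq, XT_pv a A B ha hA0 hB hp hq, XT_puu, XT_pvv]
  have e1 : Real.exp ((4 * a - 2 * B) * u) = Real.exp ((2 * a - B) * u) ^ 2 := by
    rw [← Real.exp_nat_mul]; congr 1; push_cast; ring
  have e2 : Real.exp ((2 * a + B) * u) = Real.exp ((2 * a - B) * u) * Real.exp (2 * B * u) := by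
    rw [← Real.exp_add]; congr 1; ring
  have e3 : Real.exp (2 * a * u) ^ 2 = Real.exp ((2 * a - B) * u) ^ 2 * Real.exp (2 * B * u) := by
    rw [← Real.exp_nat_mul, ← Real.exp_nat_mul, ← Real.exp_add]; congr 1; push_cast; ring
  have c1 : Real.cosh (2 * a * v) ^ 2 - Real.sinh (2 * a * v) ^ 2 = 1 := Real.cosh_sq_sub_sinh_sq _
  have c2 : Real.cosh ((2 * a + B) * v) ^ 2 - Real.sinh ((2 * a + B) * v) ^ 2 = 1 :=
    Real.cosh_sq_sub_sinh_sq _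
  have c3 : Real.cosh ((2 * a - B) * v) ^ 2 - Real.sinh ((2 * a - B) * v) ^ 2 = 1 :=
    Real.cosh_sq_sub_sinh_sq _
  have c4 : Real.cosh ((2 * a + B) * v) * Real.cosh ((2 * a - B) * v)
      + Real.sinh ((2 * a + B) * v) * Real.sinh ((2 * a - B) * v)
      = Real.cosh (2 * a * v) ^ 2 + Real.sinh (2 * a * v) ^ 2 := by
    rw [← Real.cosh_add, ← Real.cosh_two_mul]; congr 1; ring
  have c5 : Real.sinh ((2 * a + B) * v) * Real.cosh ((2 * a - B) * v)
      + Real.cosh ((2 * a + B) * v) * Real.sinh ((2 * a - B) * v)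
      = 2 * Real.sinh (2 * a * v) * Real.cosh (2 * a * v) := by
    rw [← Real.sinh_add, ← Real.sinh_two_mul]; congr 1; ring
  simp only [lint, XTu, XTv, e1, e2, sub_self, and_true]
  generalize Real.exp ((2 * a - B) * u) = Q at *
  generalize Real.exp (2 * B * u) = F at *
  generalize Real.exp (2 * a * u) = E at *
  generalize Real.cosh (2 * a * v) = C at *
  generalize Real.sinh (2 * a * v) = S at *
  generalize Real.cosh ((2 * a + B) * v) = Cp at *
  generalize Real.sinh ((2 * a + B) * v) = Sp at *
  generalize Real.cosh ((2 * a - B) * v) = Cq at *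
  generalize Real.sinh ((2 * a - B) * v) = Sq at *
  refine ⟨?_, ?_, ?_⟩
  · field_simp
    linear_combination 4 * ((4 * A ^ 2 * C ^ 2) * e3 - A ^ 4 * Q ^ 2 * F ^ 2 * c2 - Q ^ 2 * c3
      - 2 * A ^ 2 * Q ^ 2 * F * c4 + 2 * A ^ 2 * Q ^ 2 * F * c1)
  · field_simp
    linear_combination 4 * ((4 * A ^ 2 * S ^ 2) * e3 + A ^ 4 * Q ^ 2 * F ^ 2 * c2 + Q ^ 2 * c3
      - 2 * A ^ 2 * Q ^ 2 * F * c4 - 2 * A ^ 2 * Q ^ 2 * F * c1)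
  · field_simp
    linear_combination (4 * A ^ 2 * S * C) * e3 - 2 * A ^ 2 * Q ^ 2 * F * c5
end
end

section
/- Let A, B > 0. Define the frame E₁, E₂, E₃ on {u ∈ ℝ : A²e^{2Bu} ≠ 1} by E₁(u) = (1 + A²e^{2Bu}, 0, 2Ae^{Bu})/(1 − A²e^{2Bu}), E₂(u) = (0, 1, 0), E₃(u) = −(2Ae^{Bu}, 0, 1 + A²e^{2Bu})/(1 − A²e^{2Bu}), and let h(u) = 2ABe^{Bu}/(1 − A²e^{2Bu}). Then: (i) ⟨E₁,E₁⟩ = ⟨E₂,E₂⟩ = 1, ⟨E₃,E₃⟩ = −1, and ⟨E₁,E₂⟩ = ⟨E₁,E₃⟩ = ⟨E₂,E₃⟩ = 0; (ii) E₁'(u) = −h(u)·E₃(u), E₂'(u) = 0, and E₃'(u) = −h(u)·E₁(u); (iii) for a ∈ ℝ with a ≠ 0 and B ≠ ±2a, the curve c(u) = (e^{2au}/(2B))·( Ae^{Bu}/(2a+B) + e^{−Bu}/(A(2a−B)) , 0 , 1/a ) satisfies c'(u) = ρ(u)·E₁(u), where ρ(u) = (e^{2au}/(2B))·(−Ae^{Bu}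 + e^{−Bu}/A). -/
noncomputable section

open Real

/-- The tangent vector `E₁` of the frame along the profile curve (spacelike case). -/
def E1 (A B : ℝ) (u : ℝ) : ℝ × ℝ × ℝ :=
  (1 - A ^ 2 * Real.exp (2 * B * u))⁻¹ •
    ((1 + A ^ 2 * Real.exp (2 * B * u), 0, 2 * A * Real.exp (B * u)) : ℝ × ℝ × ℝ)

/-- The tangent vector `E₂` of the frame (spacelike case). -/
def E2 (u : ℝ) : ℝ × ℝ × ℝ := (0, 1, 0)

/-- The (timelike) unit normal `E₃` of the frame (spacelike case). -/
def E3 (A B : ℝ) (u : ℝ) : ℝ × ℝ × ℝ :=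
  -((1 - A ^ 2 * Real.exp (2 * B * u))⁻¹ •
    ((2 * A * Real.exp (B * u), 0, 1 + A ^ 2 * Real.exp (2 * B * u)) : ℝ × ℝ × ℝ))

/-- The coefficient `h(u) = 2ABe^{Bu}/(1 − A²e^{2Bu})`. -/
def hcoef (A B : ℝ) (u : ℝ) : ℝ :=
  2 * A * B * Real.exp (B * u) / (1 - A ^ 2 * Real.exp (2 * B * u))

/-- The profile curve `c(u) = X(u,0)` of the spacelike intrinsic rotational ZMC
surface, generic case. -/
def profc (a A B : ℝ) (u : ℝ) : ℝ × ℝ × ℝ :=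
  (Real.exp (2 * a * u) / (2 * B)) •
    ((A * Real.exp (B * u) / (2 * a + B)
        + Real.exp (-(B * u)) / (A * (2 * a - B)), 0, 1 / a) : ℝ × ℝ × ℝ)

/-- The conformal factor `ρ(u) = (e^{2au}/(2B))(−Ae^{Bu} + e^{−Bu}/A)`. -/
def rhoS (a A B : ℝ) (u : ℝ) : ℝ :=
  Real.exp (2 * a * u) / (2 * B) *
    (-(A * Real.exp (B * u)) + Real.exp (-(B * u)) / A)

theorem exp_lin_hasDerivAt (k u : ℝ) :
    HasDerivAt (fun x : ℝ => Real.exp (k * x)) (k * Real.exp (k * u)) u := by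
  have h := ((hasDerivAt_id u).const_mul k).exp
  simpa [mul_comm] using h

theorem exp_two_mul_sq (B u : ℝ) : Real.exp (2 * B * u) = Real.exp (B * u) ^ 2 := by
  rw [← Real.exp_nat_mul]; congr 1; push_cast; ring

/-- The moving frame of the spacelike intrinsic rotational ZMC surfaces along the
profile curve: orthonormality (with `E₃` timelike), the structure equations
`E₁' = −hE₃`, `E₂' = 0`, `E₃' = −hE₁`, and `c' = ρE₁` in the generic case. -/
theorem stmt16 (A B : ℝ) (hA : 0 < A) (hB : 0 < B) (u : ℝ)
    (hu : A ^ 2 * Real.exp (2 * B * u) ≠ 1) :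
    (lint (E1 A B u) (E1 A B u) = 1 ∧
     lint (E2 u) (E2 u) = 1 ∧
     lint (E3 A B u) (E3 A B u) = -1 ∧
     lint (E1 A B u) (E2 u) = 0 ∧
     lint (E1 A B u) (E3 A B u) = 0 ∧
     lint (E2 u) (E3 A B u) = 0) ∧
    (deriv (E1 A B) u = -(hcoef A B u) • E3 A B u ∧
     deriv E2 u = 0 ∧
     deriv (E3 A B) u = -(hcoef A B u) • E1 A B u) ∧
    (∀ a : ℝ, a ≠ 0 → B ≠ 2 * a → B ≠ -(2 * a) →
      deriv (profc a A B) u = rhoS a A B u • E1 A B u) := by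
  have hq : (1 - A ^ 2 * Real.exp (2 * B * u)) ≠ 0 := sub_ne_zero.mpr (Ne.symm hu)
  have hq2 : (1 - A ^ 2 * Real.exp (B * u) ^ 2) ≠ 0 := by rwa [← exp_two_mul_sq]
  have hp := Real.exp_ne_zero (B * u)
  have hA0 := hA.ne'
  have hB0 := hB.ne'
  have d1 := exp_lin_hasDerivAt B u
  have d2 := (exp_lin_hasDerivAt (2 * B) u).const_mul (A ^ 2)
  have dinv := (d2.const_sub 1).inv hq
  have f1 := dinv.mul (d2.const_add 1)
  have f3 := dinv.mul (d1.const_mul (2 * A))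
  have f0 := hasDerivAt_const u (0 : ℝ)
  refine ⟨⟨?_, ?_, ?_, ?_, ?_, ?_⟩, ⟨?_, ?_, ?_⟩, ?_⟩
  · simp only [lint, E1, Prod.smul_mk, smul_eq_mul, exp_two_mul_sq]
    field_simp
    ring
  · simp [lint, E2]
  · simp only [lint, E3, Prod.smul_mk, Prod.neg_mk, smul_eq_mul, exp_two_mul_sq]
    field_simp
    ring
  · simp [lint, E1, E2]
  · simp only [lint, E1, E3, Prod.smul_mk, Prod.neg_mk, smul_eq_mul, exp_two_mul_sq]
    field_simp
    ring
  · simp [lint, E2, E3]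
  · have hE : E1 A B = fun x => ((1 - A ^ 2 * Real.exp (2 * B * x))⁻¹ *
        (1 + A ^ 2 * Real.exp (2 * B * x)), (0 : ℝ),
        (1 - A ^ 2 * Real.exp (2 * B * x))⁻¹ * (2 * A * Real.exp (B * x))) := by
      funext x; simp [E1]
    rw [hE]
    refine (f1.prodMk (f0.prodMk f3)).deriv.trans ?_
    simp only [E3, hcoef, Pi.inv_apply, Prod.smul_mk, Prod.neg_mk, smul_eq_mul, exp_two_mul_sq]
    refine Prod.ext ?_ (Prod.ext ?_ ?_)
    · simp only; field_simp; ring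
    · simp
    · simp only; field_simp; ring
  · exact (hasDerivAt_const u ((0, 1, 0) : ℝ × ℝ × ℝ)).deriv
  · have hE : E3 A B = fun x => (-((1 - A ^ 2 * Real.exp (2 * B * x))⁻¹ *
        (2 * A * Real.exp (B * x))), (0 : ℝ),
        -((1 - A ^ 2 * Real.exp (2 * B * x))⁻¹ * (1 + A ^ 2 * Real.exp (2 * B * x)))) := by
      funext x; simp [E3]
    rw [hE]
    refine (f3.neg.prodMk (f0.prodMk f1.neg)).deriv.trans ?_
    simp only [E1, hcoef, Pi.inv_apply, Prod.smul_mk, smul_eq_mul, exp_two_mul_sq]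
    refine Prod.ext ?_ (Prod.ext ?_ ?_)
    · simp only; field_simp; ring
    · simp
    · simp only; field_simp; ring
  · intro a ha h1 h2
    have m1 : 2 * a - B ≠ 0 := fun h => h1 (by linarith)
    have m2 : 2 * a + B ≠ 0 := fun h => h2 (by linarith)
    have e0 := (exp_lin_hasDerivAt (2 * a) u).div_const (2 * B)
    have e1 := (d1.const_mul A).div_const (2 * a + B)
    have e2 := (exp_lin_hasDerivAt (-B) u).div_const (A * (2 * a - B))
    have g1 := e0.mul (e1.add e2)
    have g3 := e0.mul_const (1 / a)
    have hE : profc a A B = fun x => (Real.exp (2 * a * x) / (2 * B) *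
        (A * Real.exp (B * x) / (2 * a + B) + Real.exp (-B * x) / (A * (2 * a - B))), (0 : ℝ),
        Real.exp (2 * a * x) / (2 * B) * (1 / a)) := by
      funext x; simp [profc]
    rw [hE]
    refine (g1.prodMk (f0.prodMk g3)).deriv.trans ?_
    have hn : Real.exp (-(B * u)) = (Real.exp (B * u))⁻¹ := Real.exp_neg _
    simp only [E1, rhoS, Prod.smul_mk, smul_eq_mul, exp_two_mul_sq, neg_mul, hn, Pi.add_apply]
    generalize Real.exp (B * u) = p at *
    generalize Real.exp (2 * a * u) = q at *
    refine Prod.ext ?_ (Prod.ext ?_ ?_)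
    · simp only; field_simp; ring
    · simp
    · simp only; field_simp; ring
end
end

section
/- Let A, B > 0 and define X : ℝ² → ℝ³ by X(u,v) = ( (Ae^{Bu}/(2B²) − e^{−Bu}/(2AB²))·cos(Bv) , (Ae^{Bu}/(2B²) − e^{−Bu}/(2AB²))·sin(Bv) , u/B ). Then: (i) for all (u,v) ∈ ℝ²: ⟨X_u, X_u⟩ = ⟨X_v, X_v⟩ = (Ae^{Bu} − e^{−Bu}/A)²/(4B²), ⟨X_u, X_v⟩ = 0, and X_{uu} + X_{vv} = 0 (so away from Ae^{Bu} = e^{−Bu}/A, X is a conformally parametrized spacelike zero mean curvature surface); (ii) for every θ ∈ ℝ, Ψ_{Bθ}(X(u,v)) = X(u, v + θ), where Ψ_φ is the Euclidean rotation of ℝ³ of angle φ about the x₃-axis, Ψ_φ(x₁,x₂,x₃) = (x₁cos φ − x₂sin φ, x₁sin φ + x₂cos φ, x₃). Hence X is a surface of revolution about the x₃-axis (the elliptic catenoid). -/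
noncomputable section

open Real

/-- The untwisted spacelike intrinsic rotational ZMC surface (elliptic catenoid). -/
def Xcat (A B : ℝ) (u v : ℝ) : ℝ × ℝ × ℝ :=
  ((A * Real.exp (B * u) / (2 * B ^ 2)
      - Real.exp (-(B * u)) / (2 * A * B ^ 2)) * Real.cos (B * v),
   (A * Real.exp (B * u) / (2 * B ^ 2)
      - Real.exp (-(B * u)) / (2 * A * B ^ 2)) * Real.sin (B * v),
   u / B)

/-- The Euclidean rotation of angle `φ` about the `x₃`-axis. -/
def rotE (φ : ℝ) (x : ℝ × ℝ × ℝ) : ℝ × ℝ × ℝ :=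
  (x.1 * Real.cos φ - x.2.1 * Real.sin φ,
   x.1 * Real.sin φ + x.2.1 * Real.cos φ,
   x.2.2)

theorem hEp (B u : ℝ) : HasDerivAt (fun t => Real.exp (B * t)) (Real.exp (B * u) * B) u := by
  simpa using ((hasDerivAt_id u).const_mul B).exp

theorem hEm (B u : ℝ) :
    HasDerivAt (fun t => Real.exp (-(B * t))) (Real.exp (-(B * u)) * (-B)) u := by
  simpa using ((hasDerivAt_id u).const_mul B).neg.exp

theorem hCos (B u : ℝ) : HasDerivAt (fun t => Real.cos (B * t)) (-Real.sin (B * u) * B) u := by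
  simpa using ((hasDerivAt_id u).const_mul B).cos

theorem hSin (B u : ℝ) : HasDerivAt (fun t => Real.sin (B * t)) (Real.cos (B * u) * B) u := by
  simpa using ((hasDerivAt_id u).const_mul B).sin

theorem pu_Xcat (A B : ℝ) : pu (Xcat A B) = fun u v =>
    ((A * (Real.exp (B * u) * B) / (2 * B ^ 2)
      - Real.exp (-(B * u)) * (-B) / (2 * A * B ^ 2)) * Real.cos (B * v),
     (A * (Real.exp (B * u) * B) / (2 * B ^ 2)
      - Real.exp (-(B * u)) * (-B) / (2 * A * B ^ 2)) * Real.sin (B * v), 1 / B) := by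
  funext u v
  have hf := (((hEp B u).const_mul A).div_const (2 * B ^ 2)).sub
    ((hEm B u).div_const (2 * A * B ^ 2))
  exact ((hf.mul_const (Real.cos (B * v))).prodMk
    ((hf.mul_const (Real.sin (B * v))).prodMk ((hasDerivAt_id u).div_const B))).deriv

theorem pupu_Xcat (A B : ℝ) (u v : ℝ) : pu (pu (Xcat A B)) u v =
    ((A * (Real.exp (B * u) * B * B) / (2 * B ^ 2)
      - Real.exp (-(B * u)) * (-B) * (-B) / (2 * A * B ^ 2)) * Real.cos (B * v),
     (A * (Real.exp (B * u) * B * B) / (2 * B ^ 2)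
      - Real.exp (-(B * u)) * (-B) * (-B) / (2 * A * B ^ 2)) * Real.sin (B * v), 0) := by
  rw [pu_Xcat]
  have hf := ((((hEp B u).mul_const B).const_mul A).div_const (2 * B ^ 2)).sub
    (((hEm B u).mul_const (-B)).div_const (2 * A * B ^ 2))
  exact ((hf.mul_const (Real.cos (B * v))).prodMk
    ((hf.mul_const (Real.sin (B * v))).prodMk (hasDerivAt_const u (1 / B)))).deriv

theorem pv_Xcat (A B : ℝ) : pv (Xcat A B) = fun u v =>
    ((A * Real.exp (B * u) / (2 * B ^ 2)
      - Real.exp (-(B * u)) / (2 * A * B ^ 2)) * (-Real.sin (B * v) * B),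
     (A * Real.exp (B * u) / (2 * B ^ 2)
      - Real.exp (-(B * u)) / (2 * A * B ^ 2)) * (Real.cos (B * v) * B), 0) := by
  funext u v
  exact (((hCos B v).const_mul _).prodMk
    (((hSin B v).const_mul _).prodMk (hasDerivAt_const v (u / B)))).deriv

theorem pvpv_Xcat (A B : ℝ) (u v : ℝ) : pv (pv (Xcat A B)) u v =
    ((A * Real.exp (B * u) / (2 * B ^ 2)
      - Real.exp (-(B * u)) / (2 * A * B ^ 2)) * (-(Real.cos (B * v) * B) * B),
     (A * Real.exp (B * u) / (2 * B ^ 2)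
      - Real.exp (-(B * u)) / (2 * A * B ^ 2)) * (-Real.sin (B * v) * B * B), 0) := by
  rw [pv_Xcat]
  exact ((((hSin B v).neg.mul_const B).const_mul _).prodMk
    ((((hCos B v).mul_const B).const_mul _).prodMk (hasDerivAt_const v (0 : ℝ)))).deriv

/-- The untwisted spacelike ZMC surface is conformal and harmonic (hence of zero
mean curvature), with conformal factor `(Ae^{Bu} − e^{−Bu}/A)²/(4B²)`, and it is a
surface of revolution about the `x₃`-axis: `Ψ_{Bθ}(X(u,v)) = X(u, v+θ)`. -/
theorem stmt18 (A B : ℝ) (hA : 0 < A) (hB : 0 < B) :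
    (∀ u v : ℝ,
      lint (pu (Xcat A B) u v) (pu (Xcat A B) u v)
          = (A * Real.exp (B * u) - Real.exp (-(B * u)) / A) ^ 2 / (4 * B ^ 2) ∧
      lint (pv (Xcat A B) u v) (pv (Xcat A B) u v)
          = (A * Real.exp (B * u) - Real.exp (-(B * u)) / A) ^ 2 / (4 * B ^ 2) ∧
      lint (pu (Xcat A B) u v) (pv (Xcat A B) u v) = 0 ∧
      pu (pu (Xcat A B)) u v + pv (pv (Xcat A B)) u v = 0) ∧
    (∀ θ u v : ℝ, rotE (B * θ) (Xcat A B u v) = Xcat A B u (v + θ)) := by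
  refine ⟨fun u v => ?_, fun θ u v => ?_⟩
  · have hA' : A ≠ 0 := hA.ne'
    have hB' : B ≠ 0 := hB.ne'
    have hE : Real.exp (B * u) * Real.exp (-(B * u)) = 1 := by
      rw [← Real.exp_add]; simp
    have hS := Real.sin_sq_add_cos_sq (B * v)
    rw [pupu_Xcat, pvpv_Xcat, pu_Xcat, pv_Xcat]
    simp only [lint]
    generalize Real.exp (B * u) = e at *
    generalize Real.exp (-(B * u)) = m at *
    generalize Real.sin (B * v) = s at *
    generalize Real.cos (B * v) = c at *
    refine ⟨?_, ?_, ?_, ?_⟩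
    · have : ((A * e + m / A) / (2 * B)) ^ 2 * (s ^ 2 + c ^ 2) - (e * m) / B ^ 2
          = (A * e - m / A) ^ 2 / (4 * B ^ 2) := by
        rw [hS]; field_simp; ring
      rw [← this, hE]; field_simp; ring
    · have : ((A * e - m / A) / (2 * B)) ^ 2 * (s ^ 2 + c ^ 2)
          = (A * e - m / A) ^ 2 / (4 * B ^ 2) := by
        rw [hS]; field_simp; ring
      rw [← this]; field_simp; ring
    · ring
    · ext <;> simp <;> ring
  · simp only [rotE, Xcat, mul_add, Real.cos_add, Real.sin_add]
    ext <;> simp <;> ring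
end
end

section
/- Let A, B > 0 and define X : ℝ² → ℝ³ by X(u,v) = ( u/B , −(e^{−Bu}/(2AB²) + Ae^{Bu}/(2B²))·cosh(Bv) , −(e^{−Bu}/(2AB²) + Ae^{Bu}/(2B²))·sinh(Bv) ). Then: (i) for all (u,v) ∈ ℝ²: ⟨X_u, X_u⟩ = (Ae^{Bu} + e^{−Bu}/A)²/(4B²), ⟨X_v, X_v⟩ = −(Ae^{Bu} + e^{−Bu}/A)²/(4B²), ⟨X_u, X_v⟩ = 0, and X_{uu} − X_{vv} = 0 (so X is a timelike zero mean curvature surface); (ii) for every θ ∈ ℝ, Ψ_{Bθ}(X(u,v)) = X(u, v + θ), where Ψ_φ is the hyperbolic rotation of ℝ³ of angle φ about the x₁-axis, Ψ_φ(x₁,x₂,x₃) = (x₁, x₂cosh φ + x₃sinh φ, x₂sinh φ + x₃cosh φ). Hence X is a surface of revolution about the x₁-axis (the timelike catenoid). -/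
noncomputable section

open Real

/-- The untwisted timelike intrinsic rotational ZMC surface (timelike catenoid). -/
def Xtcat (A B : ℝ) (u v : ℝ) : ℝ × ℝ × ℝ :=
  (u / B,
   -((Real.exp (-(B * u)) / (2 * A * B ^ 2)
      + A * Real.exp (B * u) / (2 * B ^ 2)) * Real.cosh (B * v)),
   -((Real.exp (-(B * u)) / (2 * A * B ^ 2)
      + A * Real.exp (B * u) / (2 * B ^ 2)) * Real.sinh (B * v)))

/-- The hyperbolic rotation of angle `φ` about the `x₁`-axis. -/
def rotH (φ : ℝ) (x : ℝ × ℝ × ℝ) : ℝ × ℝ × ℝ :=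
  (x.1,
   x.2.1 * Real.cosh φ + x.2.2 * Real.sinh φ,
   x.2.1 * Real.sinh φ + x.2.2 * Real.cosh φ)

/-- Derivative of the profile function. -/
theorem prof_deriv (B a b u : ℝ) :
    HasDerivAt (fun t => a * Real.exp (-(B * t)) + b * Real.exp (B * t))
      (-(B * a) * Real.exp (-(B * u)) + B * b * Real.exp (B * u)) u := by
  have h : HasDerivAt (fun t : ℝ => B * t) B u := by
    simpa using (hasDerivAt_id u).const_mul B
  have h1 := (h.neg.exp.const_mul a).add (h.exp.const_mul b)
  exact h1.congr_deriv (by simp only [Pi.neg_apply]; ring)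

theorem cosh_lin_deriv (B v : ℝ) :
    HasDerivAt (fun t => Real.cosh (B * t)) (B * Real.sinh (B * v)) v := by
  have h : HasDerivAt (fun t : ℝ => B * t) B v := by
    simpa using (hasDerivAt_id v).const_mul B
  exact h.cosh.congr_deriv (by ring)

theorem sinh_lin_deriv (B v : ℝ) :
    HasDerivAt (fun t => Real.sinh (B * t)) (B * Real.cosh (B * v)) v := by
  have h : HasDerivAt (fun t : ℝ => B * t) B v := by
    simpa using (hasDerivAt_id v).const_mul B
  exact h.sinh.congr_deriv (by ring)

/-- General form of all the maps involved. -/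
def gen (B k m a b p q : ℝ) (u v : ℝ) : ℝ × ℝ × ℝ :=
  (k * u + m,
   (a * Real.exp (-(B * u)) + b * Real.exp (B * u))
      * (p * Real.cosh (B * v) + q * Real.sinh (B * v)),
   (a * Real.exp (-(B * u)) + b * Real.exp (B * u))
      * (p * Real.sinh (B * v) + q * Real.cosh (B * v)))

theorem pu_gen (B k m a b p q : ℝ) :
    pu (gen B k m a b p q) = gen B 0 k (-(B * a)) (B * b) p q := by
  funext u v
  have h0 : HasDerivAt (fun t : ℝ => k * t + m) k u := by
    simpa using ((hasDerivAt_id u).const_mul k).add_const m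
  have h := h0.prodMk (((prof_deriv B a b u).mul_const
      (p * Real.cosh (B * v) + q * Real.sinh (B * v))).prodMk
    ((prof_deriv B a b u).mul_const (p * Real.sinh (B * v) + q * Real.cosh (B * v))))
  refine h.deriv.trans ?_
  simp [gen]

/-- The `v`-derivative, for maps of the general form. -/
theorem pv_gen (B k m a b p q u v : ℝ) :
    pv (gen B k m a b p q) u v = gen B 0 0 a b (B * q) (B * p) u v := by
  have hc := cosh_lin_deriv B v
  have hs := sinh_lin_deriv B v
  have h := (hasDerivAt_const v (k * u + m)).prodMk
    ((((hc.const_mul p).add (hs.const_mul q)).const_mul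
      (a * Real.exp (-(B * u)) + b * Real.exp (B * u))).prodMk
    (((hs.const_mul p).add (hc.const_mul q)).const_mul
      (a * Real.exp (-(B * u)) + b * Real.exp (B * u))))
  refine h.deriv.trans ?_
  simp only [gen, Prod.mk.injEq]
  refine ⟨by ring, by ring, by ring⟩

theorem Xtcat_gen (A B : ℝ) :
    Xtcat A B = gen B B⁻¹ 0 (1 / (2 * A * B ^ 2)) (A / (2 * B ^ 2)) (-1) 0 := by
  funext u v
  simp only [gen, Xtcat, Prod.mk.injEq]
  refine ⟨by ring, by ring, by ring⟩

/-- The untwisted timelike ZMC surface is wave-harmonic with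
`⟨X_u,X_u⟩ = −⟨X_v,X_v⟩ = (Ae^{Bu} + e^{−Bu}/A)²/(4B²)` (hence a timelike zero mean
curvature surface), and it is a surface of revolution about the `x₁`-axis:
`Ψ_{Bθ}(X(u,v)) = X(u, v+θ)`. -/
theorem stmt19 (A B : ℝ) (hA : 0 < A) (hB : 0 < B) :
    (∀ u v : ℝ,
      lint (pu (Xtcat A B) u v) (pu (Xtcat A B) u v)
          = (A * Real.exp (B * u) + Real.exp (-(B * u)) / A) ^ 2 / (4 * B ^ 2) ∧
      lint (pv (Xtcat A B) u v) (pv (Xtcat A B) u v)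
          = -((A * Real.exp (B * u) + Real.exp (-(B * u)) / A) ^ 2 / (4 * B ^ 2)) ∧
      lint (pu (Xtcat A B) u v) (pv (Xtcat A B) u v) = 0 ∧
      pu (pu (Xtcat A B)) u v - pv (pv (Xtcat A B)) u v = 0) ∧
    (∀ θ u v : ℝ, rotH (B * θ) (Xtcat A B u v) = Xtcat A B u (v + θ)) := by
  have hA' : A ≠ 0 := hA.ne'
  have hB' : B ≠ 0 := hB.ne'
  refine ⟨fun u v => ?_, fun θ u v => ?_⟩
  · have hpv : ∀ k m a b p q : ℝ,
        pv (gen B k m a b p q) = gen B 0 0 a b (B * q) (B * p) :=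
      fun k m a b p q => funext fun u => funext fun v => pv_gen B k m a b p q u v
    rw [Xtcat_gen]
    simp only [pu_gen, hpv]
    have hcs : Real.cosh (B * v) ^ 2 = Real.sinh (B * v) ^ 2 + 1 := Real.cosh_sq _
    have hE : Real.exp (-(B * u)) = (Real.exp (B * u))⁻¹ := Real.exp_neg _
    have hE0 : Real.exp (B * u) ≠ 0 := Real.exp_ne_zero _
    simp only [gen, lint, hE]
    generalize Real.exp (B * u) = E at *
    generalize Real.cosh (B * v) = c at *
    generalize Real.sinh (B * v) = s at *
    refine ⟨?_, ?_, ?_, ?_⟩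
    · field_simp
      ring_nf
      simp only [hcs, show c ^ 2 = s ^ 2 + 1 from hcs]
      ring
    · field_simp
      ring_nf
      simp only [hcs]
      ring
    · ring
    · simp only [Prod.mk_sub_mk, Prod.mk_eq_zero]
      refine ⟨by ring, by ring, by ring⟩
  · simp only [rotH, Xtcat, mul_add, Real.cosh_add, Real.sinh_add, Prod.mk.injEq]
    refine ⟨trivial, by ring, by ring⟩
end
end
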